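/- arXiv:1808.05543 — 2 statements merged into one kernel-verified Lean document; each statement's English description precedes it below -/
import Mathlib

section
/- Let q be a power of a prime and F_q the finite field with q elements. Let A ⊆ F_q \ {0} with |A| ≥ 2 and suppose 0 ∉ A + A. Suppose there is a constant C > 0 such that for every proper subfield G of F_q and all elements c, d ∈ F_q one has |(A + A)^{-1} ∩ (cG + d)| ≤ C·max{|G|^{1/2}, |A + A|^{47/48}}. Then there is a constant C' > 0 depending only on C such that for every α ∈ F_q \ {0}, |A ∩ (α/A)| ≤ C'·(|A + A|^{1 - 1/832} + q^{-1/760}|A + A|^{1 + 1/760}). -/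
open scoped Classical Pointwise

noncomputable section

namespace STP

variable {F : Type} [Field F]

def collinearTriples (A B : Finset F) : ℕ :=
  (((A ×ˢ A ×ˢ A) ×ˢ (B ×ˢ B ×ˢ B)).filter fun x =>
    (x.1.2.1 - x.1.1) * (x.2.2.2 - x.2.1) = (x.1.2.2 - x.1.1) * (x.2.2.1 - x.2.1)).card

def IsLine (l : Set (F × F)) : Prop :=
  ∃ a b c : F, (a, b) ≠ (0, 0) ∧ l = {p : F × F | a * p.1 + b * p.2 = c}

def incidences (P : Finset (F × F)) (L : Finset (Set (F × F))) : ℕ :=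
  ((P ×ˢ L).filter fun x => x.1 ∈ x.2).card

def kIncidences (P : Finset (F × F)) (L : Finset (Set (F × F))) (k : ℕ) : ℕ :=
  (((Fintype.piFinset fun _ : Fin k => P) ×ˢ L).filter fun x => ∀ i, x.1 i ∈ x.2).card

def numLines (P : Finset (F × F)) : ℕ :=
  Set.ncard {l : Set (F × F) | IsLine l ∧ 2 ≤ (P.filter (· ∈ l)).card}

def addEnergy (X Y : Finset F) : ℕ :=
  (((X ×ˢ X) ×ˢ (Y ×ˢ Y)).filter fun t => t.1.1 + t.2.1 = t.1.2 + t.2.2).card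

def mulEnergy (A : Finset F) : ℕ :=
  (((A ×ˢ A) ×ˢ (A ×ˢ A)).filter fun t => t.1.1 * t.2.1 = t.1.2 * t.2.2).card

def quotSet (X : Finset F) : Set F :=
  {r : F | ∃ x1 ∈ X, ∃ x2 ∈ X, ∃ x3 ∈ X, ∃ x4 ∈ X, x3 ≠ x4 ∧ r = (x1 - x2) / (x3 - x4)}

def subfieldCond (A : Finset F) (C bound : ℝ) : Prop :=
  ∀ G : Subfield F, G ≠ ⊤ → ∀ c d : F,
    ((A.filter fun x => ∃ g ∈ G, x = c * g + d).card : ℝ) ≤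
      C * max ((Nat.card G : ℝ) ^ ((1:ℝ)/2)) bound

def linesOf [Fintype F] (P : Finset (F × F)) : Finset (Set (F × F)) :=
  Set.Finite.toFinset (Set.toFinite {l : Set (F × F) | IsLine l ∧ 2 ≤ (P.filter (· ∈ l)).card})

def tripleCount [Fintype F] (P : Finset (F × F)) : ℕ :=
  ∑ l ∈ linesOf P, ((P.filter (· ∈ l)).card) ^ 3


/-! ### Dilates with small sumset -/

/-- `GoodDil X L r`: the sumset `X + r X` has size at most `L |X|`. -/
def GoodDil (X : Finset F) (L : ℝ) (r : F) : Prop := ((X + r • X).card : ℝ) ≤ L * X.card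

theorem pr_ineq {X : Finset F} (hne : X.Nonempty) {M : ℝ}
    (hM : ((X + X).card : ℝ) ≤ M * X.card) (m k : ℕ) :
    ((m • X - k • X).card : ℝ) ≤ M ^ (m + k) * X.card := by
  have h := Finset.pluennecke_ruzsa_inequality_nsmul_sub_nsmul_add hne X m k
  have h' : ((m • X - k • X).card : ℝ) ≤ (((X + X).card : ℝ) / X.card) ^ (m + k) * X.card := by
    have h2 := (NNRat.cast_le (K := ℝ)).2 h
    push_cast at h2
    exact h2
  have hpos : (0 : ℝ) < X.card := by exact_mod_cast hne.card_pos
  refine h'.trans ?_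
  gcongr
  rw [div_le_iff₀ hpos]
  exact hM

theorem goodDil_one_le {X : Finset F} (hne : X.Nonempty) {L : ℝ} {r : F}
    (h : GoodDil X L r) : 1 ≤ L := by
  have hpos : (0 : ℝ) < X.card := by exact_mod_cast hne.card_pos
  have h1 : X.card ≤ (X + r • X).card := Finset.card_le_card_add_right (by simpa using hne)
  have h2 : (X.card : ℝ) ≤ (X + r • X).card := by exact_mod_cast h1
  have h3 : (1 : ℝ) * X.card ≤ L * X.card := by
    rw [one_mul]; exact h2.trans h
  exact le_of_mul_le_mul_right h3 hpos

theorem goodDil_cover {X : Finset F} (hne : X.Nonempty) {L : ℝ} {r : F}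
    (h : GoodDil X L r) : ∃ T : Finset F, (T.card : ℝ) ≤ L ∧ r • X ⊆ T + (X - X) := by
  obtain ⟨T, _, h1, h2⟩ := Finset.ruzsa_covering_add (A := r • X) (B := X) (K := L) hne
    (by rw [add_comm]; exact h)
  exact ⟨T, h1, h2⟩

theorem goodDil_mono {X : Finset F} {L L' : ℝ} {r : F} (h : GoodDil X L r) (hL : L ≤ L') :
    GoodDil X L' r := by
  unfold GoodDil at *
  exact h.trans (by gcongr)

theorem goodDil_add {X : Finset F} (hne : X.Nonempty) {M : ℝ}
    (hM : ((X + X).card : ℝ) ≤ M * X.card) (hM1 : 1 ≤ M) {L L' : ℝ} {r s : F}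
    (hr : GoodDil X L r) (hs : GoodDil X L' s) : GoodDil X (L * L' * M ^ 5) (r + s) := by
  obtain ⟨T, hT, hT'⟩ := goodDil_cover hne hr
  obtain ⟨U, hU, hU'⟩ := goodDil_cover hne hs
  have hL := goodDil_one_le hne hr
  have hL' := goodDil_one_le hne hs
  have hsub : X + (r + s) • X ⊆ (T + U) + (3 • X - 2 • X) := by
    have e3 : 3 • X = X + X + X := by simp only [succ_nsmul, zero_nsmul, zero_add]
    have e2 : 2 • X = X + X := by simp only [succ_nsmul, zero_nsmul, zero_add]
    intro w hw
    obtain ⟨x, hx, w', hw', rfl⟩ := Finset.mem_add.1 hw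
    obtain ⟨y, hy, rfl⟩ := Finset.mem_smul_finset.1 hw'
    obtain ⟨t, ht, w1, hw1, h1⟩ := Finset.mem_add.1 (hT' (Finset.smul_mem_smul_finset hy))
    obtain ⟨a, ha, b, hb, rfl⟩ := Finset.mem_sub.1 hw1
    obtain ⟨u, hu, w2, hw2, h2⟩ := Finset.mem_add.1 (hU' (Finset.smul_mem_smul_finset hy))
    obtain ⟨c, hc, d, hd, rfl⟩ := Finset.mem_sub.1 hw2
    have e : x + (r + s) • y = (t + u) + ((x + a + c) - (b + d)) := by
      rw [add_smul, ← h1, ← h2]; ring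
    rw [e, e3, e2]
    exact Finset.add_mem_add (Finset.add_mem_add ht hu) (Finset.sub_mem_sub
      (Finset.add_mem_add (Finset.add_mem_add hx ha) hc) (Finset.add_mem_add hb hd))
  have h1 := pr_ineq hne hM 3 2
  have h2 : ((X + (r + s) • X).card : ℝ) ≤ (T.card * U.card) * (3 • X - 2 • X).card := by
    have := (Finset.card_le_card hsub).trans Finset.card_add_le
    have h3 : (T + U).card ≤ T.card * U.card := Finset.card_add_le
    have := this.trans (Nat.mul_le_mul_right _ h3)
    exact_mod_cast this
  unfold GoodDil
  calc ((X + (r + s) • X).card : ℝ) ≤ (T.card * U.card) * (3 • X - 2 • X).card := h2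
    _ ≤ (L * L') * (M ^ (3 + 2) * X.card) := by gcongr
    _ = _ := by ring

theorem goodDil_neg {X : Finset F} (hne : X.Nonempty) {M : ℝ}
    (hM : ((X + X).card : ℝ) ≤ M * X.card) (hM1 : 1 ≤ M) {L : ℝ} {r : F}
    (hr : GoodDil X L r) : GoodDil X (L * M ^ 3) (-r) := by
  obtain ⟨T, hT, hT'⟩ := goodDil_cover hne hr
  have hL := goodDil_one_le hne hr
  have hsub : X + (-r) • X ⊆ (-T) + (2 • X - 1 • X) := by
    have e2 : 2 • X = X + X := by simp only [succ_nsmul, zero_nsmul, zero_add]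
    intro w hw
    obtain ⟨x, hx, w', hw', rfl⟩ := Finset.mem_add.1 hw
    obtain ⟨y, hy, rfl⟩ := Finset.mem_smul_finset.1 hw'
    obtain ⟨t, ht, w1, hw1, h1⟩ := Finset.mem_add.1 (hT' (Finset.smul_mem_smul_finset hy))
    obtain ⟨a, ha, b, hb, rfl⟩ := Finset.mem_sub.1 hw1
    have e : x + (-r) • y = (-t) + ((x + b) - a) := by
      rw [neg_smul, ← h1]; ring
    rw [e, one_nsmul, e2]
    exact Finset.add_mem_add (Finset.neg_mem_neg ht) (Finset.sub_mem_sub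
      (Finset.add_mem_add hx hb) ha)
  have h1 := pr_ineq hne hM 2 1
  have h2 : ((X + (-r) • X).card : ℝ) ≤ T.card * (2 • X - 1 • X).card := by
    have := (Finset.card_le_card hsub).trans Finset.card_add_le
    rw [Finset.card_neg] at this
    exact_mod_cast this
  unfold GoodDil
  calc ((X + (-r) • X).card : ℝ) ≤ T.card * (2 • X - 1 • X).card := h2
    _ ≤ L * (M ^ (2 + 1) * X.card) := by gcongr
    _ = _ := by ring

theorem goodDil_zero {X : Finset F} (hne : X.Nonempty) {L : ℝ} (hL : 1 ≤ L) :
    GoodDil X L 0 := by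
  unfold GoodDil
  rw [Finset.zero_smul_finset hne, add_zero]
  nlinarith [(Nat.cast_nonneg X.card : (0 : ℝ) ≤ X.card)]

theorem goodDil_mul {X : Finset F} (hne : X.Nonempty) {L L' : ℝ} {r s : F}
    (hr : GoodDil X L r) (hs : GoodDil X L' s) : GoodDil X (L * L') (r * s) := by
  have hL := goodDil_one_le hne hr
  have hL' := goodDil_one_le hne hs
  by_cases h0 : r = 0
  · subst h0
    rw [zero_mul]
    exact goodDil_zero hne (by nlinarith)
  have hpos : (0 : ℝ) < X.card := by exact_mod_cast hne.card_pos
  have h := Finset.ruzsa_triangle_inequality_add_add_add X (r • X) ((r * s) • X)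
  have e : r • X + (r * s) • X = r • (X + s • X) := by
    rw [smul_add, smul_smul]
  rw [e, Finset.card_smul_finset₀ h0, Finset.card_smul_finset₀ h0] at h
  have h' : ((X + (r * s) • X).card : ℝ) * X.card ≤ (X + r • X).card * (X + s • X).card := by
    exact_mod_cast h
  unfold GoodDil at *
  refine le_of_mul_le_mul_right (h'.trans ?_) hpos
  calc ((X + r • X).card : ℝ) * (X + s • X).card ≤ (L * X.card) * (L' * X.card) := by gcongr
    _ = _ := by ring

theorem goodDil_inv {X : Finset F} {L : ℝ} {r : F}
    (hr : GoodDil X L r) : GoodDil X L r⁻¹ := by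
  by_cases h0 : r = 0
  · subst h0; simpa using hr
  unfold GoodDil at *
  have e : X + r • X = r • (X + r⁻¹ • X) := by
    rw [smul_add, smul_smul, mul_inv_cancel₀ h0, one_smul, add_comm]
  rwa [e, Finset.card_smul_finset₀ h0] at hr

/-- Few dilates are good. -/
theorem goodDil_card {X : Finset F} (hne : X.Nonempty) {L : ℝ} (hL : 1 ≤ L)
    (hbig : 2 * L ≤ X.card) (H : Finset F) (hH : ∀ r ∈ H, GoodDil X L r) :
    (H.card : ℝ) ≤ 2 * L * X.card := by
  have hpos : (0 : ℝ) < X.card := by exact_mod_cast hne.card_pos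
  -- quadruples
  let f : F → F × F → F := fun r p => p.1 + r * p.2
  have hlow : ∀ r ∈ H, (X.card : ℝ) ^ 3 ≤ L *
      ((((X ×ˢ X) ×ˢ (X ×ˢ X)).filter fun t => f r t.1 = f r t.2).card : ℝ) := by
    intro r hr
    have hmap : ((X ×ˢ X : Finset (F × F)) : Set (F × F)).MapsTo (f r) (X + r • X : Finset F) := by
      intro p hp
      simp only [Finset.coe_product, Set.mem_prod, Finset.mem_coe] at hp
      exact Finset.add_mem_add hp.1 (Finset.smul_mem_smul_finset hp.2)
    have h1 := Finset.card_eq_sum_card_fiberwise hmap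
    have h2 : (((X ×ˢ X) ×ˢ (X ×ˢ X)).filter fun t => f r t.1 = f r t.2).card
        = ∑ b ∈ X + r • X, ((X ×ˢ X).filter fun p => f r p = b).card ^ 2 := by
      have hm : (((((X ×ˢ X) ×ˢ (X ×ˢ X)).filter fun t => f r t.1 = f r t.2) :
          Finset ((F × F) × (F × F))) : Set ((F × F) × (F × F))).MapsTo
          (fun t => f r t.1) (X + r • X : Finset F) := by
        intro t ht
        simp only [Finset.coe_filter, Set.mem_ofPred_eq, Finset.mem_product] at ht
        exact hmap (by simpa using ht.1.1)
      rw [Finset.card_eq_sum_card_fiberwise hm]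
      refine Finset.sum_congr rfl fun b _ => ?_
      rw [sq, ← Finset.card_product]
      congr 1
      ext ⟨p, p'⟩
      simp only [Finset.mem_filter, Finset.mem_product]
      constructor
      · rintro ⟨⟨⟨h1, h2⟩, h3⟩, h4⟩
        exact ⟨⟨h1, h4⟩, h2, h3 ▸ h4⟩
      · rintro ⟨⟨h1, h4⟩, h2, h3⟩
        exact ⟨⟨⟨h1, h2⟩, h4.trans h3.symm⟩, h4⟩
    have h3 := sq_sum_le_card_mul_sum_sq (s := X + r • X)
      (f := fun b => (((X ×ˢ X).filter fun p => f r p = b).card : ℝ))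
    have h1' : ∑ b ∈ X + r • X, (((X ×ˢ X).filter fun p => f r p = b).card : ℝ)
        = X.card * X.card := by
      have := h1.symm
      rw [Finset.card_product] at this
      exact_mod_cast this
    rw [h1'] at h3
    have h2' : ((((X ×ˢ X) ×ˢ (X ×ˢ X)).filter fun t => f r t.1 = f r t.2).card : ℝ)
        = ∑ b ∈ X + r • X, (((X ×ˢ X).filter fun p => f r p = b).card : ℝ) ^ 2 := by
      rw [h2]; push_cast; rfl
    rw [← h2'] at h3
    have h4 : ((X.card : ℝ) * X.card) ^ 2 ≤ (L * X.card) *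
      ((((X ×ˢ X) ×ˢ (X ×ˢ X)).filter fun t => f r t.1 = f r t.2).card : ℝ) :=
      h3.trans (mul_le_mul_of_nonneg_right (hH r hr) (Nat.cast_nonneg _))
    refine le_of_mul_le_mul_right ?_ hpos
    linarith [h4]
  -- upper bound
  have hup : (∑ r ∈ H, (((X ×ˢ X) ×ˢ (X ×ˢ X)).filter fun t => f r t.1 = f r t.2).card)
      ≤ H.card * X.card ^ 2 + X.card ^ 4 := by
    have e1 : (∑ r ∈ H, (((X ×ˢ X) ×ˢ (X ×ˢ X)).filter fun t => f r t.1 = f r t.2).card)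
        = ∑ t ∈ (X ×ˢ X) ×ˢ (X ×ˢ X), (H.filter fun r => f r t.1 = f r t.2).card := by
      simp only [Finset.card_filter]
      exact Finset.sum_comm
    rw [e1]
    have e2 : ∀ t ∈ (X ×ˢ X) ×ˢ (X ×ˢ X), (H.filter fun r => f r t.1 = f r t.2).card
        ≤ (if t.1 = t.2 then H.card else 0) + 1 := by
      intro t _
      split_ifs with h
      · exact (Finset.card_filter_le _ _).trans (Nat.le_succ _)
      · rw [zero_add, Finset.card_le_one]
        intro a ha b hb
        simp only [Finset.mem_filter, f] at ha hb
        have h2 : t.1.2 ≠ t.2.2 := by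
          intro h2
          apply h
          have := ha.2
          rw [h2] at this
          exact Prod.ext (add_right_cancel this) h2
        have h3 : (a - b) * (t.1.2 - t.2.2) = 0 := by linear_combination ha.2 - hb.2
        rcases mul_eq_zero.1 h3 with h4 | h4
        · exact sub_eq_zero.1 h4
        · exact absurd (sub_eq_zero.1 h4) h2
    refine (Finset.sum_le_sum e2).trans ?_
    rw [Finset.sum_add_distrib]
    have e3 : (∑ t ∈ (X ×ˢ X) ×ˢ (X ×ˢ X), if t.1 = t.2 then H.card else 0)
        ≤ H.card * X.card ^ 2 := by
      rw [← Finset.sum_filter, Finset.sum_const, smul_eq_mul, mul_comm]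
      refine Nat.mul_le_mul_left _ ?_
      have : (((X ×ˢ X) ×ˢ (X ×ˢ X)).filter fun t => t.1 = t.2).card ≤ (X ×ˢ X).card := by
        refine Finset.card_le_card_of_injOn (fun t => t.1) ?_ ?_
        · intro t ht
          simp only [Finset.coe_filter, Set.mem_ofPred_eq] at ht
          exact (Finset.mem_product.1 ht.1).1
        · intro t ht t' ht' h
          simp only [Finset.coe_filter, Set.mem_ofPred_eq] at ht ht'
          exact Prod.ext h (ht.2.symm.trans (h.trans ht'.2))
      rw [Finset.card_product] at this
      rw [sq]; exact this
    have e4 : (∑ t ∈ (X ×ˢ X) ×ˢ (X ×ˢ X), 1) = X.card ^ 4 := by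
      simp only [Finset.sum_const, Finset.card_product, smul_eq_mul]; ring
    rw [e4]
    exact Nat.add_le_add_right e3 _
  have hsum : (H.card : ℝ) * (X.card : ℝ) ^ 3 ≤ L * (H.card * X.card ^ 2 + X.card ^ 4) := by
    calc (H.card : ℝ) * (X.card : ℝ) ^ 3 = ∑ r ∈ H, (X.card : ℝ) ^ 3 := by
          rw [Finset.sum_const, nsmul_eq_mul]
      _ ≤ ∑ r ∈ H, L *
        ((((X ×ˢ X) ×ˢ (X ×ˢ X)).filter fun t => f r t.1 = f r t.2).card : ℝ) :=
          Finset.sum_le_sum hlow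
      _ = L * ((∑ r ∈ H, (((X ×ˢ X) ×ˢ (X ×ˢ X)).filter
            fun t => f r t.1 = f r t.2).card : ℕ) : ℝ) := by
          rw [← Finset.mul_sum]; push_cast; rfl
      _ ≤ _ := by
          refine mul_le_mul_of_nonneg_left ?_ (by linarith)
          exact_mod_cast hup
  have hn2 : (0 : ℝ) < (X.card : ℝ) ^ 2 := by positivity
  have h5 : (H.card : ℝ) * X.card ≤ L * (H.card + X.card ^ 2) := by
    refine le_of_mul_le_mul_right ?_ hn2
    linarith [hsum]
  have h6 : (0 : ℝ) ≤ H.card := Nat.cast_nonneg _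
  have h7 : (H.card : ℝ) * (2 * L) ≤ H.card * X.card := by gcongr
  have h8 : (H.card : ℝ) * X.card ≤ 2 * L * X.card * X.card := by nlinarith
  exact le_of_mul_le_mul_right h8 hpos

/-! ### From good dilates to a subfield -/

theorem mem_quot_of_small {X : Finset F} (hne : X.Nonempty) {L2 : ℝ} (h1 : 1 ≤ L2)
    (hbig : 2 * L2 ≤ X.card) (Θ : Finset F) (hΘ : 2 * L2 * X.card < (Θ.card : ℝ) ^ 2) (r : F)
    (hr : ∀ s ∈ Θ, ∀ t ∈ Θ, GoodDil X L2 (s + r * t)) : r ∈ quotSet Θ := by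
  by_contra hnot
  have hinj : Set.InjOn (fun p : F × F => p.1 + r * p.2) (Θ ×ˢ Θ : Finset (F × F)) := by
    rintro ⟨a, b⟩ hab ⟨c, d⟩ hcd h
    simp only [Finset.coe_product, Set.mem_prod, Finset.mem_coe] at hab hcd
    simp only at h
    by_cases hbd : b = d
    · subst hbd
      rw [add_right_cancel h]
    · exfalso
      apply hnot
      refine ⟨a, hab.1, c, hcd.1, d, hcd.2, b, hab.2, fun h' => hbd h'.symm, ?_⟩
      rw [eq_div_iff (sub_ne_zero.2 fun h' => hbd h'.symm)]
      linear_combination -h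
  have hc := Finset.card_image_of_injOn hinj
  have hg := goodDil_card hne h1 hbig ((Θ ×ˢ Θ).image fun p : F × F => p.1 + r * p.2) (by
    intro x hx
    obtain ⟨p, hp, rfl⟩ := Finset.mem_image.1 hx
    exact hr _ (Finset.mem_product.1 hp).1 _ (Finset.mem_product.1 hp).2)
  rw [hc, Finset.card_product] at hg
  push_cast at hg
  nlinarith

theorem exists_subfield {X : Finset F} (hne : X.Nonempty) {M : ℝ}
    (hM : ((X + X).card : ℝ) ≤ M * X.card) (hM1 : 1 ≤ M) {L0 : ℝ} (hL0 : 1 ≤ L0)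
    (Θ : Finset F) (hgood : ∀ t ∈ Θ, GoodDil X L0 t) (h2 : 1 < Θ.card)
    (hbig : 2 * (L0 ^ 10 * M ^ 42) ≤ X.card)
    (hΘ : 2 * (L0 ^ 10 * M ^ 42) * X.card < (Θ.card : ℝ) ^ 2) :
    ∃ G : Subfield F, (∀ r, r ∈ G ↔ r ∈ quotSet Θ) ∧ ∀ g ∈ G, GoodDil X (L0 ^ 4 * M ^ 16) g := by
  have hR : ∀ r ∈ quotSet Θ, GoodDil X (L0 ^ 4 * M ^ 16) r := by
    rintro r ⟨t1, h1, t2, h2, t3, h3, t4, h4, _, rfl⟩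
    have hd : ∀ a ∈ Θ, ∀ b ∈ Θ, GoodDil X (L0 * (L0 * M ^ 3) * M ^ 5) (a - b) := by
      intro a ha b hb
      rw [sub_eq_add_neg]
      exact goodDil_add hne hM hM1 (hgood a ha) (goodDil_neg hne hM hM1 (hgood b hb))
    have := goodDil_mul hne (hd t1 h1 t2 h2) (goodDil_inv (hd t3 h3 t4 h4))
    rw [div_eq_mul_inv]
    convert this using 1
    ring
  have hL2 : 1 ≤ L0 ^ 10 * M ^ 42 := one_le_mul_of_one_le_of_one_le (one_le_pow₀ hL0)
    (one_le_pow₀ hM1)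
  have hcl : ∀ r, GoodDil X (L0 ^ 8 * M ^ 37) r → r ∈ quotSet Θ := by
    intro r hr
    refine mem_quot_of_small hne hL2 hbig Θ hΘ r fun s hs t ht => ?_
    have := goodDil_add hne hM hM1 (hgood s hs) (goodDil_mul hne hr (hgood t ht))
    convert this using 1
    ring
  have hM0 : 0 < M := by linarith
  have hL00 : 0 < L0 := by linarith
  obtain ⟨u, hu, v, hv, huv⟩ := Finset.one_lt_card.1 h2
  let G : Subfield F :=
    { carrier := quotSet Θ
      zero_mem' := ⟨u, hu, u, hu, u, hu, v, hv, huv, by simp⟩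
      one_mem' := ⟨u, hu, v, hv, u, hu, v, hv, huv, by
        rw [div_self (sub_ne_zero.2 huv)]⟩
      add_mem' := by
        intro a b ha hb
        apply hcl
        have := goodDil_add hne hM hM1 (hR a ha) (hR b hb)
        convert this using 1
        ring
      mul_mem' := by
        intro a b ha hb
        apply hcl
        refine goodDil_mono (goodDil_mul hne (hR a ha) (hR b hb)) ?_
        calc L0 ^ 4 * M ^ 16 * (L0 ^ 4 * M ^ 16) = L0 ^ 8 * M ^ 32 := by ring
          _ ≤ L0 ^ 8 * M ^ 37 := by gcongr <;> first | exact hM1 | norm_num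
      neg_mem' := by
        rintro a ⟨t1, h1, t2, h2, t3, h3, t4, h4, h, rfl⟩
        exact ⟨t2, h2, t1, h1, t3, h3, t4, h4, h, by ring⟩
      inv_mem' := by
        rintro a ⟨t1, h1, t2, h2, t3, h3, t4, h4, h, rfl⟩
        by_cases h12 : t1 = t2
        · subst h12
          exact ⟨t1, h1, t1, h1, t3, h3, t4, h4, h, by simp⟩
        · exact ⟨t3, h3, t4, h4, t1, h1, t2, h2, h12, by rw [inv_div]⟩ }
  exact ⟨G, fun r => Iff.rfl, fun g hg => hR g hg⟩

/-- Covering by few cosets of `c G` plus inversion symmetry gives density in `c G`. -/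
theorem dense_in_dilate {X : Finset F} {α : F} (hα : α ≠ 0) (h0 : (0 : F) ∉ X)
    (hinv : ∀ x ∈ X, α * x⁻¹ ∈ X) (G : Subfield F) {c : F} (hc : c ≠ 0) (T : Finset F)
    (hT : ∀ x ∈ X, ∃ t ∈ T, ∃ g ∈ G, x = t + c * g) :
    X.card ≤ (X.filter fun x => ∃ g ∈ G, x = c * g).card + 2 * T.card ^ 2 := by
  rw [← Finset.card_filter_add_card_filter_not (s := X) (fun x => ∃ g ∈ G, x = c * g)]
  refine Nat.add_le_add_left ?_ _
  choose! τ hτ g hg hx using hT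
  have hmaps : ∀ x ∈ X.filter (fun x => ¬ ∃ g ∈ G, x = c * g),
      (τ x, τ (α * x⁻¹)) ∈ T ×ˢ T := by
    intro x hx
    have hx := (Finset.mem_filter.1 hx).1
    exact Finset.mem_product.2 ⟨hτ _ hx, hτ _ (hinv _ hx)⟩
  have h := Finset.card_le_mul_card_image_of_maps_to hmaps 2 ?_
  · rwa [Finset.card_product, ← sq] at h
  · rintro ⟨t, t'⟩ _
    by_contra hlt
    replace hlt := not_le.1 hlt
    obtain ⟨x, hx1, y, hy1, z, hz1, hxy, hxz, hyz⟩ := Finset.two_lt_card.1 hlt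
    simp only [Finset.mem_filter, Prod.mk.injEq] at hx1 hy1 hz1
    have key : ∀ a ∈ X, ∀ b ∈ X, τ a = t → τ b = t → τ (α * a⁻¹) = t' → τ (α * b⁻¹) = t' →
        a ≠ b → α / (a * b) ∈ G := by
      intro a ha b hb h1 h2 h3 h4 hab
      have ha0 : a ≠ 0 := fun h => h0 (h ▸ ha)
      have hb0 : b ≠ 0 := fun h => h0 (h ▸ hb)
      have e1 : a - b = c * (g a - g b) := by
        linear_combination hx a ha - hx b hb + h1 - h2
      have e2 : α * a⁻¹ - α * b⁻¹ = c * (g (α * a⁻¹) - g (α * b⁻¹)) := by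
        linear_combination hx _ (hinv a ha) - hx _ (hinv b hb) + h3 - h4
      have e3 : α * a⁻¹ - α * b⁻¹ = - (α / (a * b)) * (a - b) := by
        field_simp; ring
      have hne : g a - g b ≠ 0 := by
        intro h
        rw [h, mul_zero] at e1
        exact hab (sub_eq_zero.1 e1)
      have e4 : α / (a * b) = - ((g (α * a⁻¹) - g (α * b⁻¹)) / (g a - g b)) := by
        rw [← neg_div, eq_div_iff hne]
        refine mul_left_cancel₀ hc ?_
        rw [e2, e1] at e3
        linear_combination e3
      rw [e4]
      exact G.neg_mem (G.div_mem (G.sub_mem (hg _ (hinv a ha)) (hg _ (hinv b hb)))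
        (G.sub_mem (hg _ ha) (hg _ hb)))
    have k1 := key x hx1.1.1 y hy1.1.1 hx1.2.1 hy1.2.1 hx1.2.2 hy1.2.2 hxy
    have k2 := key x hx1.1.1 z hz1.1.1 hx1.2.1 hz1.2.1 hx1.2.2 hz1.2.2 hxz
    have x0 : x ≠ 0 := fun h => h0 (h ▸ hx1.1.1)
    have y0 : y ≠ 0 := fun h => h0 (h ▸ hy1.1.1)
    have z0 : z ≠ 0 := fun h => h0 (h ▸ hz1.1.1)
    have k3 : y / z ∈ G := by
      have := G.div_mem k2 k1
      have e : α / (x * z) / (α / (x * y)) = y / z := by field_simp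
      rwa [e] at this
    have e1 : y - z = c * (g y - g z) := by
      linear_combination hx y hy1.1.1 - hx z hz1.1.1 + hy1.2.1 - hz1.2.1
    have hne : y / z - 1 ≠ 0 := by
      intro h
      rw [sub_eq_zero, div_eq_one_iff_eq z0] at h
      exact hyz h
    apply hz1.1.2
    refine ⟨(g y - g z) / (y / z - 1), G.div_mem (G.sub_mem (hg _ hy1.1.1) (hg _ hz1.1.1))
      (G.sub_mem k3 G.one_mem), ?_⟩
    rw [← mul_div_assoc, ← e1, eq_div_iff hne]
    field_simp

/-! ### Counting closed six-walks -/

theorem collision_count {ι κ : Type*} (S : Finset ι) (P : Finset κ) (h : ι → κ)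
    (hm : ∀ s ∈ S, h s ∈ P) :
    S.card ^ 2 ≤ P.card * ((S ×ˢ S).filter fun p => h p.1 = h p.2).card := by
  have h1 : S.card = ∑ p ∈ P, (S.filter fun s => h s = p).card :=
    Finset.card_eq_sum_card_fiberwise hm
  have h2 : ((S ×ˢ S).filter fun p => h p.1 = h p.2).card
      = ∑ p ∈ P, (S.filter fun s => h s = p).card ^ 2 := by
    rw [Finset.card_eq_sum_card_fiberwise (f := fun p : ι × ι => h p.1) (t := P)]
    · refine Finset.sum_congr rfl fun p _ => ?_
      rw [sq, ← Finset.card_product]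
      congr 1
      ext ⟨a, b⟩
      simp only [Finset.mem_filter, Finset.mem_product]
      constructor
      · rintro ⟨⟨⟨ha, hb⟩, hab⟩, hp⟩
        exact ⟨⟨ha, hp⟩, hb, hab ▸ hp⟩
      · rintro ⟨⟨ha, hp⟩, hb, hp'⟩
        exact ⟨⟨⟨ha, hb⟩, hp.trans hp'.symm⟩, hp⟩
    · intro p hp
      exact hm _ (Finset.mem_product.1 (Finset.mem_filter.1 hp).1).1
  rw [h2]
  conv_lhs => rw [h1]
  exact sq_sum_le_card_mul_sum_sq

theorem sum_inv_fiber {ι κ : Type*} (S : Finset ι) (P : Finset κ) (h : ι → κ)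
    (hm : ∀ s ∈ S, h s ∈ P) :
    ∑ v ∈ S, (1 : ℝ) / (S.filter fun s => h s = h v).card ≤ P.card := by
  rw [← Finset.sum_fiberwise_of_maps_to hm]
  calc ∑ p ∈ P, ∑ v ∈ S.filter (fun s => h s = p), (1 : ℝ) / (S.filter fun s => h s = h v).card
      ≤ ∑ p ∈ P, (1 : ℝ) := by
        refine Finset.sum_le_sum fun p _ => ?_
        have : ∀ v ∈ S.filter (fun s => h s = p), (1 : ℝ) / (S.filter fun s => h s = h v).card
            = 1 / (S.filter fun s => h s = p).card := by
          intro v hv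
          rw [(Finset.mem_filter.1 hv).2]
        rw [Finset.sum_congr rfl this, Finset.sum_const, nsmul_eq_mul, mul_one_div]
        exact div_self_le_one _
    _ = P.card := by simp

theorem amgm3 {u w : ℝ} (hu : 0 < u) (hw : 0 < w) : 3 ≤ u * w + 1 / u + 1 / w := by
  obtain ⟨a, ha, rfl⟩ : ∃ a : ℝ, 0 < a ∧ u = a ^ 2 :=
    ⟨√u, Real.sqrt_pos.2 hu, (Real.sq_sqrt hu.le).symm⟩
  obtain ⟨b, hb, rfl⟩ : ∃ b : ℝ, 0 < b ∧ w = b ^ 2 :=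
    ⟨√w, Real.sqrt_pos.2 hw, (Real.sq_sqrt hw.le).symm⟩
  have hp : 0 < a * b := mul_pos ha hb
  have e : a ^ 2 * b ^ 2 + 1 / a ^ 2 + 1 / b ^ 2 =
      ((a * b) ^ 4 + a ^ 2 + b ^ 2) / (a * b) ^ 2 := by
    field_simp; ring
  rw [e, le_div_iff₀ (by positivity)]
  have h1 : 0 ≤ (a * b) * ((a * b - 1) ^ 2 * (a * b + 2)) := by positivity
  nlinarith [sq_nonneg (a - b)]

theorem three_walks {ι β γ : Type*} (V : Finset ι) (f : ι → β) (g : ι → γ)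
    (PA : Finset β) (PB : Finset γ) (hf : ∀ v ∈ V, f v ∈ PA) (hg : ∀ v ∈ V, g v ∈ PB) :
    (V.card : ℝ) ^ 3 ≤ PA.card * PB.card *
      ((V ×ˢ V ×ˢ V).filter fun p => g p.1 = g p.2.1 ∧ f p.2.1 = f p.2.2).card := by
  rcases V.eq_empty_or_nonempty with rfl | ⟨v0, hv0⟩
  · simp
  have he : (0 : ℝ) < V.card := by exact_mod_cast Finset.card_pos.2 ⟨v0, hv0⟩
  have hA : (0 : ℝ) < PA.card := by exact_mod_cast Finset.card_pos.2 ⟨_, hf _ hv0⟩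
  have hB : (0 : ℝ) < PB.card := by exact_mod_cast Finset.card_pos.2 ⟨_, hg _ hv0⟩
  have hW : (((V ×ˢ V ×ˢ V).filter fun p => g p.1 = g p.2.1 ∧ f p.2.1 = f p.2.2).card : ℝ)
      = ∑ v ∈ V, ((V.filter fun s => f s = f v).card : ℝ) * (V.filter fun s => g s = g v).card := by
    rw [Finset.card_eq_sum_card_fiberwise (f := fun p : ι × ι × ι => p.2.1) (t := V)]
    · push_cast
      refine Finset.sum_congr rfl fun v hv => ?_
      rw [← Nat.cast_mul, ← Finset.card_product]
      congr 1
      refine Finset.card_bij (fun p _ => (p.2.2, p.1)) ?_ ?_ ?_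
      · rintro ⟨a, b, c⟩ h
        simp only [Finset.mem_filter, Finset.mem_product] at h ⊢
        obtain ⟨⟨⟨ha, hb, hc⟩, h1, h2⟩, rfl⟩ := h
        exact ⟨⟨hc, h2.symm⟩, ha, h1⟩
      · rintro ⟨a, b, c⟩ h ⟨a', b', c'⟩ h' h''
        simp only [Finset.mem_filter, Finset.mem_product, Prod.mk.injEq] at h h' h'' ⊢
        exact ⟨h''.2, h.2.trans h'.2.symm, h''.1⟩
      · rintro ⟨c, a⟩ h
        simp only [Finset.mem_filter, Finset.mem_product] at h
        refine ⟨(a, v, c), ?_, rfl⟩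
        simp only [Finset.mem_filter, Finset.mem_product]
        exact ⟨⟨⟨h.2.1, hv, h.1.1⟩, h.2.2, h.1.2.symm⟩, trivial⟩
    · intro p hp
      exact (Finset.mem_product.1 (Finset.mem_product.1 (Finset.mem_filter.1 hp).1).2).1
  rw [hW]
  have h1 := sum_inv_fiber V PA f hf
  have h2 := sum_inv_fiber V PB g hg
  have key : ∑ v ∈ V, (3 : ℝ) ≤ ∑ v ∈ V,
      (PA.card * PB.card / (V.card : ℝ) ^ 2 *
        (((V.filter fun s => f s = f v).card : ℝ) * (V.filter fun s => g s = g v).card)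
      + V.card / PA.card * (1 / (V.filter fun s => f s = f v).card)
      + V.card / PB.card * (1 / (V.filter fun s => g s = g v).card)) := by
    refine Finset.sum_le_sum fun v hv => ?_
    have d1 : (0 : ℝ) < (V.filter fun s => f s = f v).card := by
      have : 0 < (V.filter fun s => f s = f v).card :=
        Finset.card_pos.2 ⟨v, Finset.mem_filter.2 ⟨hv, rfl⟩⟩
      exact_mod_cast this
    have d2 : (0 : ℝ) < (V.filter fun s => g s = g v).card := by
      have : 0 < (V.filter fun s => g s = g v).card :=
        Finset.card_pos.2 ⟨v, Finset.mem_filter.2 ⟨hv, rfl⟩⟩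
      exact_mod_cast this
    have := amgm3 (u := PA.card / V.card * (V.filter fun s => f s = f v).card)
      (w := PB.card / V.card * (V.filter fun s => g s = g v).card) (by positivity) (by positivity)
    refine this.trans (le_of_eq ?_)
    field_simp
  rw [Finset.sum_add_distrib, Finset.sum_add_distrib, ← Finset.mul_sum, ← Finset.mul_sum,
    ← Finset.mul_sum, Finset.sum_const, nsmul_eq_mul] at key
  have h3 := mul_le_mul_of_nonneg_left h1 (by positivity : (0 : ℝ) ≤ V.card / PA.card)
  have h4 := mul_le_mul_of_nonneg_left h2 (by positivity : (0 : ℝ) ≤ V.card / PB.card)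
  rw [div_mul_cancel₀ _ hA.ne'] at h3
  rw [div_mul_cancel₀ _ hB.ne'] at h4
  set S := ∑ v ∈ V, ((V.filter fun s => f s = f v).card : ℝ) * (V.filter fun s => g s = g v).card
  have h5 : (V.card : ℝ) ≤ PA.card * PB.card / (V.card : ℝ) ^ 2 * S := by linarith
  rw [div_mul_eq_mul_div, le_div_iff₀ (by positivity)] at h5
  nlinarith

theorem six_walks {ι β γ : Type*} (V : Finset ι) (f : ι → β) (g : ι → γ)
    (PA : Finset β) (PB : Finset γ) (hf : ∀ v ∈ V, f v ∈ PA) (hg : ∀ v ∈ V, g v ∈ PB) :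
    (V.card : ℝ) ^ 6 ≤ (PA.card * PB.card) ^ 3 *
      (((V ×ˢ V ×ˢ V) ×ˢ (V ×ˢ V ×ˢ V)).filter fun p : (ι × ι × ι) × (ι × ι × ι) =>
        (g p.1.1 = g p.1.2.1 ∧ f p.1.2.1 = f p.1.2.2) ∧
        (g p.2.1 = g p.2.2.1 ∧ f p.2.2.1 = f p.2.2.2) ∧
        f p.1.1 = f p.2.1 ∧ g p.1.2.2 = g p.2.2.2).card := by
  have h3 := three_walks V f g PA PB hf hg
  set S := (V ×ˢ V ×ˢ V).filter fun p => g p.1 = g p.2.1 ∧ f p.2.1 = f p.2.2 with hS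
  have hc := collision_count S (PA ×ˢ PB) (fun p => (f p.1, g p.2.2)) (by
    intro p hp
    have := (Finset.mem_filter.1 hp).1
    simp only [Finset.mem_product] at this ⊢
    exact ⟨hf _ this.1, hg _ this.2.2⟩)
  have hc' : (S.card : ℝ) ^ 2 ≤ PA.card * PB.card *
      (((S ×ˢ S).filter fun p => (f p.1.1, g p.1.2.2) = (f p.2.1, g p.2.2.2)).card : ℝ) := by
    rw [Finset.card_product] at hc
    have hc2 := (Nat.cast_le (α := ℝ)).2 hc
    push_cast at hc2
    refine hc2.trans (le_of_eq ?_)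
    congr!
  have e : ((S ×ˢ S).filter fun p => (f p.1.1, g p.1.2.2) = (f p.2.1, g p.2.2.2)) =
      (((V ×ˢ V ×ˢ V) ×ˢ (V ×ˢ V ×ˢ V)).filter fun p : (ι × ι × ι) × (ι × ι × ι) =>
        (g p.1.1 = g p.1.2.1 ∧ f p.1.2.1 = f p.1.2.2) ∧
        (g p.2.1 = g p.2.2.1 ∧ f p.2.2.1 = f p.2.2.2) ∧
        f p.1.1 = f p.2.1 ∧ g p.1.2.2 = g p.2.2.2) := by
    ext p
    simp only [hS, Finset.mem_filter, Finset.mem_product, Prod.mk.injEq]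
    tauto
  rw [e] at hc'
  set N := (((V ×ˢ V ×ˢ V) ×ˢ (V ×ˢ V ×ˢ V)).filter fun p : (ι × ι × ι) × (ι × ι × ι) =>
        (g p.1.1 = g p.1.2.1 ∧ f p.1.2.1 = f p.1.2.2) ∧
        (g p.2.1 = g p.2.2.1 ∧ f p.2.2.1 = f p.2.2.2) ∧
        f p.1.1 = f p.2.1 ∧ g p.1.2.2 = g p.2.2.2).card
  calc (V.card : ℝ) ^ 6 = ((V.card : ℝ) ^ 3) ^ 2 := by ring
    _ ≤ ((PA.card : ℝ) * PB.card * S.card) ^ 2 := by gcongr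
    _ = ((PA.card : ℝ) * PB.card) ^ 2 * (S.card : ℝ) ^ 2 := by ring
    _ ≤ ((PA.card : ℝ) * PB.card) ^ 2 * (PA.card * PB.card * N) := by gcongr
    _ = _ := by ring

theorem six_walks' {ι β γ : Type*} (V : Finset ι) (f : ι → β) (g : ι → γ)
    (PA : Finset β) (PB : Finset γ) (hf : ∀ v ∈ V, f v ∈ PA) (hg : ∀ v ∈ V, g v ∈ PB) :
    ∃ S : Finset ((ι × ι × ι) × (ι × ι × ι)),
      (∀ p ∈ S, p ∈ (V ×ˢ V ×ˢ V) ×ˢ (V ×ˢ V ×ˢ V) ∧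
        (g p.1.1 = g p.1.2.1 ∧ f p.1.2.1 = f p.1.2.2) ∧
        (g p.2.1 = g p.2.2.1 ∧ f p.2.2.1 = f p.2.2.2) ∧
        f p.1.1 = f p.2.1 ∧ g p.1.2.2 = g p.2.2.2) ∧
      (V.card : ℝ) ^ 6 ≤ (PA.card * PB.card) ^ 3 * S.card :=
  ⟨_, fun _ hp => Finset.mem_filter.1 hp, six_walks V f g PA PB hf hg⟩

/-! ### The Möbius identity coming from a closed six-walk -/

theorem mobius_point {x p q r q' p' a b c d b' c' : F} (hx : x ≠ 0) (hp : p ≠ 0) (hq : q ≠ 0)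
    (hr : r ≠ 0) (hq' : q' ≠ 0) (hp' : p' ≠ 0) (h1 : p⁻¹ = x⁻¹ + d) (h2 : q = p + c)
    (h3 : r⁻¹ = q⁻¹ + b) (h4 : q' = x + c') (h5 : p'⁻¹ = q'⁻¹ + b') (h6 : r = p' + a) :
    ((1 + c * d) * x + c) * (b' * x + (1 + b' * c')) =
      ((1 + a * b') * x + (c' + a * (1 + b' * c'))) * ((d + b * (1 + c * d)) * x + (1 + b * c)) := by
  have e1 : p * (1 + d * x) = x := by field_simp at h1; linear_combination -h1
  have e3 : r * (1 + b * q) = q := by field_simp at h3; linear_combination -h3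
  have e5 : p' * (1 + b' * q') = q' := by field_simp at h5; linear_combination -h5
  have f1 : r * ((d + b * (1 + c * d)) * x + (1 + b * c)) = (1 + c * d) * x + c := by
    subst h2
    linear_combination (1 + d * x) * e3 + (1 - b * r) * e1
  have f2 : r * (b' * x + (1 + b' * c')) = (1 + a * b') * x + (c' + a * (1 + b' * c')) := by
    subst h6 h4
    linear_combination e5
  rw [← f1, ← f2]
  ring

theorem quad_zero {u v w x y z : F} (hxy : x ≠ y) (hxz : x ≠ z) (hyz : y ≠ z)
    (hx : u * x ^ 2 + v * x + w = 0) (hy : u * y ^ 2 + v * y + w = 0)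
    (hz : u * z ^ 2 + v * z + w = 0) : u = 0 ∧ v = 0 ∧ w = 0 := by
  have h1 : u * (x + y) + v = 0 := by
    apply mul_left_cancel₀ (sub_ne_zero.2 hxy)
    linear_combination hx - hy
  have h2 : u * (x + z) + v = 0 := by
    apply mul_left_cancel₀ (sub_ne_zero.2 hxz)
    linear_combination hx - hz
  have h3 : u = 0 := by
    apply mul_left_cancel₀ (sub_ne_zero.2 hyz)
    linear_combination h1 - h2
  subst h3
  have h4 : v = 0 := by linear_combination h1
  subst h4
  exact ⟨rfl, rfl, by linear_combination hx⟩

theorem mobius_eq {A1 B1 C1 D1 A2 B2 C2 D2 : F} (h1 : A1 * D1 - B1 * C1 = 1)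
    (h2 : A2 * D2 - B2 * C2 = 1) (e1 : A1 * C2 = A2 * C1)
    (e2 : A1 * D2 + B1 * C2 = A2 * D1 + B2 * C1) (e3 : B1 * D2 = B2 * D1) :
    ∃ κ : F, (κ = 1 ∨ κ = -1) ∧ A1 = κ * A2 ∧ B1 = κ * B2 ∧ C1 = κ * C2 ∧ D1 = κ * D2 := by
  have a1 : A1 = (A1 * D2 - B2 * C1) * A2 := by linear_combination -A1 * h2 - B2 * e1
  have a2 : B1 = (A1 * D2 - B2 * C1) * B2 := by
    linear_combination -B1 * h2 - B2 * e2 + A2 * e3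
  have a3 : C1 = (A1 * D2 - B2 * C1) * C2 := by linear_combination -C1 * h2 - D2 * e1
  have a4 : D1 = (A1 * D2 - B2 * C1) * D2 := by
    linear_combination -D1 * h2 - D2 * e2 + C2 * e3
  refine ⟨A1 * D2 - B2 * C1, ?_, a1, a2, a3, a4⟩
  generalize A1 * D2 - B2 * C1 = κ at *
  subst a1 a2 a3 a4
  exact sq_eq_one_iff.1 (by linear_combination h1 - κ ^ 2 * h2)

/-- The relations satisfied by the parameters of a closed six-walk. -/
def WalkRel (κ : F) (a b c d b' c' : F) : Prop :=
  1 + c * d = κ * (1 + a * b') ∧ c = κ * (c' + a * (1 + b' * c')) ∧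
    d + b * (1 + c * d) = κ * b' ∧ 1 + b * c = κ * (1 + b' * c')

theorem walk_rel {a b c d b' c' x y z : F} (hxy : x ≠ y) (hxz : x ≠ z) (hyz : y ≠ z)
    (h : ∀ t, t = x ∨ t = y ∨ t = z → ((1 + c * d) * t + c) * (b' * t + (1 + b' * c')) =
      ((1 + a * b') * t + (c' + a * (1 + b' * c'))) *
        ((d + b * (1 + c * d)) * t + (1 + b * c))) :
    ∃ κ : F, (κ = 1 ∨ κ = -1) ∧ WalkRel κ a b c d b' c' := by
  have hq := quad_zero (u := (1 + c * d) * b' - (1 + a * b') * (d + b * (1 + c * d)))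
    (v := (1 + c * d) * (1 + b' * c') + c * b' - ((1 + a * b') * (1 + b * c)
      + (c' + a * (1 + b' * c')) * (d + b * (1 + c * d))))
    (w := c * (1 + b' * c') - (c' + a * (1 + b' * c')) * (1 + b * c))
    (x := x) (y := y) (z := z) hxy hxz hyz (by linear_combination h x (by simp))
    (by linear_combination h y (by simp)) (by linear_combination h z (by simp))
  exact mobius_eq (by ring) (by ring) (sub_eq_zero.1 hq.1) (sub_eq_zero.1 hq.2.1)
    (sub_eq_zero.1 hq.2.2)

/-! ### Counting parameters -/

theorem param_count (D D' : Finset F) (m : ℕ) (hD : D.card ≤ m) (hD' : D'.card ≤ m) (κ : F)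
    (hκ : κ = 1 ∨ κ = -1) :
    (((D ×ˢ D' ×ˢ D) ×ˢ (D' ×ˢ D' ×ˢ D)).filter fun t : (F × F × F) × (F × F × F) =>
      WalkRel κ t.1.1 t.1.2.1 t.1.2.2 t.2.1 t.2.2.1 t.2.2.2).card ≤
    3 * m ^ 2 + ((D' ×ˢ D ×ˢ D').filter fun t : F × F × F =>
      t.1 ≠ 0 ∧ ∃ a ∈ D, 1 + t.2.1 * t.2.2 = κ * (1 + a * t.1)).card := by
  set W := ((D ×ˢ D' ×ˢ D) ×ˢ (D' ×ˢ D' ×ˢ D)).filter fun t : (F × F × F) × (F × F × F) =>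
      WalkRel κ t.1.1 t.1.2.1 t.1.2.2 t.2.1 t.2.2.1 t.2.2.2 with hW
  have hκ2 : κ * κ = 1 := by rcases hκ with rfl | rfl <;> ring
  have hκ0 : κ ≠ 0 := by rintro rfl; simp at hκ2
  set W1 := W.filter fun t => 1 + t.1.2.2 * t.2.1 = 0
  set W2 := W.filter fun t => t.2.2.1 = 0 ∧ t.1.2.1 ≠ 0
  set W3 := W.filter fun t => t.2.2.1 = 0 ∧ t.1.2.1 = 0
  set W4 := W.filter fun t => 1 + t.1.2.2 * t.2.1 ≠ 0 ∧ t.2.2.1 ≠ 0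
  have hcov : W ⊆ W1 ∪ W2 ∪ W3 ∪ W4 := by
    intro t ht
    simp only [Finset.mem_union, W1, W2, W3, W4, Finset.mem_filter, ht, true_and]
    tauto
  have hprod : ∀ {S T : Finset F}, S.card ≤ m → T.card ≤ m → (S ×ˢ T).card ≤ m ^ 2 := by
    intro S T h1 h2
    rw [Finset.card_product, sq]
    exact Nat.mul_le_mul h1 h2
  have c1 : W1.card ≤ m ^ 2 := by
    refine le_trans ?_ (hprod hD hD')
    refine Finset.card_le_card_of_injOn (fun t => (t.1.2.2, t.1.2.1)) ?_ ?_
    · rintro ⟨⟨a, b, c⟩, d, b', c'⟩ ht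
      simp only [W1, hW, Finset.coe_filter, Set.mem_ofPred_eq, Finset.mem_filter, Finset.mem_product, Finset.coe_product, Set.mem_prod, Finset.mem_coe] at ht ⊢
      exact ⟨ht.1.1.1.2.2, ht.1.1.1.2.1⟩
    · rintro ⟨⟨a, b, c⟩, d, b', c'⟩ ht ⟨⟨a1, b1, c1⟩, d1, b1', c1'⟩ ht1 h
      simp only [W1, hW, Finset.coe_filter, Set.mem_ofPred_eq, Finset.mem_filter, Finset.mem_product, Prod.mk.injEq] at ht ht1 h ⊢
      obtain ⟨rfl, rfl⟩ := h
      obtain ⟨⟨_, e1, e2, e3, e4⟩, e5⟩ := ht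
      obtain ⟨⟨_, f1, f2, f3, f4⟩, f5⟩ := ht1
      have hc : c ≠ 0 := by rintro rfl; simp at e5
      have hd : d = d1 := mul_left_cancel₀ hc (by linear_combination e5 - f5)
      subst hd
      have hb' : b' = b1' := mul_left_cancel₀ hκ0 (by linear_combination f3 - e3)
      subst hb'
      have hd0 : d ≠ 0 := by rintro rfl; simp at e5
      have hb0 : b' ≠ 0 := by
        rintro rfl
        apply hd0
        linear_combination e3 - b * e5
      have ha : a = a1 := mul_left_cancel₀ (mul_ne_zero hκ0 hb0) (by linear_combination f1 - e1)
      have hc' : c' = c1' := mul_left_cancel₀ (mul_ne_zero hκ0 hb0) (by linear_combination f4 - e4)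
      simp [ha, hc']
  have c2 : W2.card ≤ m ^ 2 := by
    refine le_trans ?_ (hprod hD hD')
    refine Finset.card_le_card_of_injOn (fun t => (t.1.1, t.1.2.1)) ?_ ?_
    · rintro ⟨⟨a, b, c⟩, d, b', c'⟩ ht
      simp only [W2, hW, Finset.coe_filter, Set.mem_ofPred_eq, Finset.mem_filter, Finset.mem_product, Finset.coe_product, Set.mem_prod, Finset.mem_coe] at ht ⊢
      exact ⟨ht.1.1.1.1, ht.1.1.1.2.1⟩
    · rintro ⟨⟨a, b, c⟩, d, b', c'⟩ ht ⟨⟨a1, b1, c1⟩, d1, b1', c1'⟩ ht1 h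
      simp only [W2, hW, Finset.coe_filter, Set.mem_ofPred_eq, Finset.mem_filter, Finset.mem_product, Prod.mk.injEq] at ht ht1 h ⊢
      obtain ⟨rfl, rfl⟩ := h
      obtain ⟨⟨_, e1, e2, e3, e4⟩, rfl, hb⟩ := ht
      obtain ⟨⟨_, f1, f2, f3, f4⟩, rfl, _⟩ := ht1
      have hc : c = c1 := mul_left_cancel₀ hb (by linear_combination e4 - f4)
      subst hc
      have hd : d = d1 := by linear_combination e3 - b * e1 - f3 + b * f1
      have hc' : c' = c1' := mul_left_cancel₀ hκ0 (by linear_combination f2 - e2)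
      simp [hd, hc']
  have c3 : W3.card ≤ m ^ 2 := by
    refine le_trans ?_ (hprod hD hD)
    refine Finset.card_le_card_of_injOn (fun t => (t.1.1, t.2.2.2)) ?_ ?_
    · rintro ⟨⟨a, b, c⟩, d, b', c'⟩ ht
      simp only [W3, hW, Finset.coe_filter, Set.mem_ofPred_eq, Finset.mem_filter, Finset.mem_product, Finset.coe_product, Set.mem_prod, Finset.mem_coe] at ht ⊢
      exact ⟨ht.1.1.1.1, ht.1.1.2.2.2⟩
    · rintro ⟨⟨a, b, c⟩, d, b', c'⟩ ht ⟨⟨a1, b1, c1⟩, d1, b1', c1'⟩ ht1 h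
      simp only [W3, hW, Finset.coe_filter, Set.mem_ofPred_eq, Finset.mem_filter, Finset.mem_product, Prod.mk.injEq] at ht ht1 h ⊢
      obtain ⟨rfl, rfl⟩ := h
      obtain ⟨⟨_, e1, e2, e3, e4⟩, rfl, rfl⟩ := ht
      obtain ⟨⟨_, f1, f2, f3, f4⟩, rfl, rfl⟩ := ht1
      have hc : c = c1 := by linear_combination e2 - f2
      have hd : d = d1 := by linear_combination e3 - f3
      simp [hc, hd]
  have c4 : W4.card ≤ ((D' ×ˢ D ×ˢ D').filter fun t : F × F × F =>
      t.1 ≠ 0 ∧ ∃ a ∈ D, 1 + t.2.1 * t.2.2 = κ * (1 + a * t.1)).card := by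
    refine Finset.card_le_card_of_injOn (fun t => (t.2.2.1, t.1.2.2, t.2.1)) ?_ ?_
    · rintro ⟨⟨a, b, c⟩, d, b', c'⟩ ht
      simp only [W4, hW, Finset.coe_filter, Set.mem_ofPred_eq, Finset.mem_filter, Finset.mem_product] at ht ⊢
      exact ⟨⟨ht.1.1.2.2.1, ht.1.1.1.2.2, ht.1.1.2.1⟩, ht.2.2, a, ht.1.1.1.1, ht.1.2.1⟩
    · rintro ⟨⟨a, b, c⟩, d, b', c'⟩ ht ⟨⟨a1, b1, c1⟩, d1, b1', c1'⟩ ht1 h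
      simp only [W4, hW, Finset.coe_filter, Set.mem_ofPred_eq, Finset.mem_filter, Finset.mem_product, Prod.mk.injEq] at ht ht1 h ⊢
      obtain ⟨rfl, rfl, rfl⟩ := h
      obtain ⟨⟨_, e1, e2, e3, e4⟩, e5, hb0⟩ := ht
      obtain ⟨⟨_, f1, f2, f3, f4⟩, _⟩ := ht1
      have ha : a = a1 := mul_left_cancel₀ (mul_ne_zero hκ0 hb0) (by linear_combination f1 - e1)
      have hb : b = b1 := mul_left_cancel₀ e5 (by linear_combination e3 - f3)
      subst hb
      have hc' : c' = c1' := mul_left_cancel₀ (mul_ne_zero hκ0 hb0) (by linear_combination f4 - e4)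
      simp [ha, hc']
  have := Finset.card_le_card hcov
  have u1 := Finset.card_union_le (W1 ∪ W2 ∪ W3) W4
  have u2 := Finset.card_union_le (W1 ∪ W2) W3
  have u3 := Finset.card_union_le W1 W2
  omega

/-- Ordered triples of distinct elements. -/
def distinctTriples (X : Finset F) : Finset (F × F × F) :=
  (X ×ˢ X ×ˢ X).filter fun v => v.1 ≠ v.2.1 ∧ v.1 ≠ v.2.2 ∧ v.2.1 ≠ v.2.2

theorem card_distinctTriples (X : Finset F) (h6 : 6 ≤ X.card) :
    (X.card : ℝ) ^ 3 ≤ 2 * (distinctTriples X).card := by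
  have hcov : X ×ˢ X ×ˢ X ⊆ distinctTriples X ∪
      ((X ×ˢ X).image fun p => (p.1, p.1, p.2)) ∪ ((X ×ˢ X).image fun p => (p.1, p.2, p.1)) ∪
      ((X ×ˢ X).image fun p => (p.2, p.1, p.1)) := by
    rintro ⟨a, b, c⟩ h
    simp only [Finset.mem_product] at h
    simp only [Finset.mem_union, Finset.mem_image, distinctTriples, Finset.mem_filter,
      Finset.mem_product, Prod.exists, Prod.mk.injEq]
    by_cases h1 : a = b
    · exact Or.inl (Or.inl (Or.inr ⟨a, c, ⟨h.1, h.2.2⟩, rfl, h1, rfl⟩))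
    by_cases h2 : a = c
    · exact Or.inl (Or.inr ⟨a, b, ⟨h.1, h.2.1⟩, rfl, rfl, h2⟩)
    by_cases h3 : b = c
    · exact Or.inr ⟨b, a, ⟨h.2.1, h.1⟩, rfl, rfl, h3⟩
    exact Or.inl (Or.inl (Or.inl ⟨h, h1, h2, h3⟩))
  have h1 := Finset.card_le_card hcov
  have u1 := Finset.card_union_le (distinctTriples X ∪
      ((X ×ˢ X).image fun p => (p.1, p.1, p.2)) ∪ ((X ×ˢ X).image fun p => (p.1, p.2, p.1)))
      ((X ×ˢ X).image fun p => (p.2, p.1, p.1))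
  have u2 := Finset.card_union_le (distinctTriples X ∪
      ((X ×ˢ X).image fun p => (p.1, p.1, p.2))) ((X ×ˢ X).image fun p => (p.1, p.2, p.1))
  have u3 := Finset.card_union_le (distinctTriples X) ((X ×ˢ X).image fun p => (p.1, p.1, p.2))
  have i1 := Finset.card_image_le (s := X ×ˢ X) (f := fun p => (p.1, p.1, p.2))
  have i2 := Finset.card_image_le (s := X ×ˢ X) (f := fun p => (p.1, p.2, p.1))
  have i3 := Finset.card_image_le (s := X ×ˢ X) (f := fun p => (p.2, p.1, p.1))
  simp only [Finset.card_product] at h1 i1 i2 i3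
  have h2 : X.card * (X.card * X.card) ≤ (distinctTriples X).card + 3 * (X.card * X.card) := by
    omega
  have h3 : (X.card : ℝ) * (X.card * X.card) ≤ (distinctTriples X).card + 3 * (X.card * X.card) := by
    exact_mod_cast h2
  have h6' : (6 : ℝ) ≤ X.card := by exact_mod_cast h6
  nlinarith [mul_nonneg (sub_nonneg.2 h6') (sq_nonneg (X.card : ℝ))]

theorem card_distinctTriples_le (X : Finset F) :
    ((distinctTriples X).card : ℝ) ≤ (X.card : ℝ) ^ 3 := by
  have h : (distinctTriples X).card ≤ X.card * (X.card * X.card) := by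
    refine (Finset.card_filter_le _ _).trans ?_
    simp only [Finset.card_product, le_refl]
  calc ((distinctTriples X).card : ℝ) ≤ (X.card * (X.card * X.card) : ℕ) := by exact_mod_cast h
    _ = _ := by push_cast; ring

def fmap (v : F × F × F) : F × F := (v.2.1 - v.1, v.2.2 - v.1)
def gmap (v : F × F × F) : F × F := (v.2.1⁻¹ - v.1⁻¹, v.2.2⁻¹ - v.1⁻¹)

theorem fmap_shift {u v : F × F × F} (h : fmap u = fmap v) :
    v.1 = u.1 + (v.1 - u.1) ∧ v.2.1 = u.2.1 + (v.1 - u.1) ∧ v.2.2 = u.2.2 + (v.1 - u.1) := by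
  simp only [fmap, Prod.mk.injEq] at h
  refine ⟨by ring, by linear_combination -h.1, by linear_combination -h.2⟩

theorem gmap_shift {u v : F × F × F} (h : gmap u = gmap v) :
    v.1⁻¹ = u.1⁻¹ + (v.1⁻¹ - u.1⁻¹) ∧ v.2.1⁻¹ = u.2.1⁻¹ + (v.1⁻¹ - u.1⁻¹) ∧
      v.2.2⁻¹ = u.2.2⁻¹ + (v.1⁻¹ - u.1⁻¹) := by
  simp only [gmap, Prod.mk.injEq] at h
  refine ⟨by ring, by linear_combination -h.1, by linear_combination -h.2⟩

theorem fmap_inj {u u' v v' : F × F × F} (h : fmap u = fmap v) (h' : fmap u' = fmap v')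
    (hu : u = u') (hd : v.1 - u.1 = v'.1 - u'.1) : v = v' := by
  subst hu
  have a := fmap_shift h
  have b := fmap_shift h'
  rw [hd] at a
  exact Prod.ext (a.1.trans b.1.symm) (Prod.ext (a.2.1.trans b.2.1.symm) (a.2.2.trans b.2.2.symm))

theorem gmap_inj {u u' v v' : F × F × F} (h : gmap u = gmap v) (h' : gmap u' = gmap v')
    (hu : u = u') (hd : v.1⁻¹ - u.1⁻¹ = v'.1⁻¹ - u'.1⁻¹) : v = v' := by
  subst hu
  have a := gmap_shift h
  have b := gmap_shift h'
  rw [hd] at a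
  exact Prod.ext (inv_inj.1 (a.1.trans b.1.symm)) (Prod.ext (inv_inj.1 (a.2.1.trans b.2.1.symm))
    (inv_inj.1 (a.2.2.trans b.2.2.symm)))

def walkParams (p : ((F × F × F) × (F × F × F) × (F × F × F)) ×
    ((F × F × F) × (F × F × F) × (F × F × F))) : (F × F × F) × (F × F × F) :=
  ((p.2.2.2.1 - p.2.2.1.1, p.2.2.2.1⁻¹ - p.1.2.2.1⁻¹, p.1.2.2.1 - p.1.2.1.1),
    (p.1.2.1.1⁻¹ - p.1.1.1⁻¹, p.2.2.1.1⁻¹ - p.2.1.1⁻¹, p.2.1.1 - p.1.1.1))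

theorem walk_arith {n M d v s w w' : ℝ} (hn : 0 < n) (hM1 : 1 ≤ M) (hd0 : 0 ≤ d)
    (hd : d ≤ M ^ 2 * n) (hv0 : 0 ≤ v) (hlow : n ^ 3 ≤ 2 * v) (hup : v ≤ n ^ 3)
    (hw0 : 0 ≤ w) (hs : s ≤ v * w) (hw : w ≤ w') (h : v ^ 6 ≤ (d * d * (d * d)) ^ 3 * s) :
    n ^ 3 ≤ 2 ^ 6 * M ^ 24 * w' := by
  have hM0 : 0 < M := by linarith
  have hS2 : s ≤ n ^ 3 * w' := hs.trans (by gcongr)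
  have h1 : (n ^ 3 / 2) ^ 6 ≤ ((M ^ 2 * n * (M ^ 2 * n)) * (M ^ 2 * n * (M ^ 2 * n))) ^ 3 *
      (n ^ 3 * w') := by
    calc (n ^ 3 / 2) ^ 6 ≤ v ^ 6 := by
          gcongr; linarith
      _ ≤ (d * d * (d * d)) ^ 3 * s := h
      _ ≤ (d * d * (d * d)) ^ 3 * (n ^ 3 * w') := by gcongr
      _ ≤ _ := by
        have : 0 ≤ w' := hw0.trans hw
        gcongr
  have h2 : n ^ 15 * n ^ 3 ≤ n ^ 15 * (2 ^ 6 * M ^ 24 * w') := by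
    have e : n ^ 15 * n ^ 3 = 2 ^ 6 * (n ^ 3 / 2) ^ 6 := by ring
    rw [e]
    refine (mul_le_mul_of_nonneg_left h1 (by norm_num)).trans (le_of_eq (by ring))
  exact le_of_mul_le_mul_left h2 (by positivity)

set_option maxHeartbeats 1000000 in
theorem walk_count {X : Finset F} {α : F} (hα : α ≠ 0) (h0 : (0 : F) ∉ X)
    (hinv : ∀ x ∈ X, α * x⁻¹ ∈ X) {M : ℝ}
    (hM : ((X + X).card : ℝ) ≤ M * X.card) (hM1 : 1 ≤ M) (h6 : 6 ≤ X.card) :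
    ∃ κ : F, (κ = 1 ∨ κ = -1) ∧ (X.card : ℝ) ^ 3 ≤ 2 ^ 7 * M ^ 24 *
      ((((X - X) ×ˢ (α⁻¹ • (X - X)) ×ˢ (X - X)) ×ˢ
        ((α⁻¹ • (X - X)) ×ˢ (α⁻¹ • (X - X)) ×ˢ (X - X))).filter
        fun t : (F × F × F) × (F × F × F) =>
        WalkRel κ t.1.1 t.1.2.1 t.1.2.2 t.2.1 t.2.2.1 t.2.2.2).card := by
  have hne : X.Nonempty := Finset.card_pos.1 (by omega)
  have hn : (0 : ℝ) < X.card := by exact_mod_cast hne.card_pos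
  have hD : ((X - X).card : ℝ) ≤ M ^ 2 * X.card := by
    have := pr_ineq hne hM 1 1
    simpa using this
  set V := distinctTriples X with hV
  set D := X - X with hDdef
  set D' := α⁻¹ • D with hD'def
  have hD'c : D'.card = D.card := Finset.card_smul_finset₀ (inv_ne_zero hα) _
  have hD'mem : ∀ x ∈ X, ∀ y ∈ X, x⁻¹ - y⁻¹ ∈ D' := by
    intro x hx y hy
    refine Finset.mem_smul_finset.2 ⟨α * x⁻¹ - α * y⁻¹, Finset.sub_mem_sub (hinv x hx) (hinv y hy), ?_⟩
    rw [smul_eq_mul]; field_simp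
  have hVm : ∀ v ∈ V, v.1 ∈ X ∧ v.2.1 ∈ X ∧ v.2.2 ∈ X := by
    intro v hv
    have := (Finset.mem_filter.1 hv).1
    simpa only [Finset.mem_product] using this
  obtain ⟨S, hS, hwalk⟩ := six_walks' V fmap gmap (D ×ˢ D) (D' ×ˢ D') (by
    intro v hv
    obtain ⟨a, b, c⟩ := hVm v hv
    exact Finset.mem_product.2 ⟨Finset.sub_mem_sub b a, Finset.sub_mem_sub c a⟩) (by
    intro v hv
    obtain ⟨a, b, c⟩ := hVm v hv
    exact Finset.mem_product.2 ⟨hD'mem _ b _ a, hD'mem _ c _ a⟩)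
  have hSm : ∀ p ∈ S, (p.1.1 ∈ V ∧ p.1.2.1 ∈ V ∧ p.1.2.2 ∈ V ∧ p.2.1 ∈ V ∧ p.2.2.1 ∈ V ∧ p.2.2.2 ∈ V)
      ∧ (gmap p.1.1 = gmap p.1.2.1 ∧ fmap p.1.2.1 = fmap p.1.2.2) ∧
        (gmap p.2.1 = gmap p.2.2.1 ∧ fmap p.2.2.1 = fmap p.2.2.2) ∧
        fmap p.1.1 = fmap p.2.1 ∧ gmap p.1.2.2 = gmap p.2.2.2 := by
    intro p hp
    obtain ⟨h1, h2⟩ := hS p hp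
    simp only [Finset.mem_product] at h1
    exact ⟨⟨h1.1.1, h1.1.2.1, h1.1.2.2, h1.2.1, h1.2.2.1, h1.2.2.2⟩, h2⟩
  set W := fun κ : F => ((D ×ˢ D' ×ˢ D) ×ˢ (D' ×ˢ D' ×ˢ D)).filter
        fun t : (F × F × F) × (F × F × F) =>
        WalkRel κ t.1.1 t.1.2.1 t.1.2.2 t.2.1 t.2.2.1 t.2.2.2 with hW
  -- fibres over the first vertex
  have hfib : ∀ v ∈ V, (S.filter fun p => p.1.1 = v).card ≤ (W 1 ∪ W (-1)).card := by
    intro v hv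
    refine Finset.card_le_card_of_injOn walkParams ?_ ?_
    · intro p hp
      obtain ⟨hp, -⟩ := Finset.mem_filter.1 hp
      obtain ⟨⟨m1, m2, m3, m4, m5, m6⟩, ⟨g1, f1⟩, ⟨g2, f2⟩, f3, g3⟩ := hSm p hp
      have n1 := hVm _ m1
      have n2 := hVm _ m2
      have n3 := hVm _ m3
      have n4 := hVm _ m4
      have n5 := hVm _ m5
      have n6 := hVm _ m6
      have s1 := gmap_shift g1
      have s2 := fmap_shift f1
      have s3 := gmap_shift g3
      have s4 := fmap_shift f3
      have s5 := gmap_shift g2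
      have s6 := fmap_shift f2
      have nz : ∀ x ∈ X, x ≠ 0 := fun x hx h => h0 (h ▸ hx)
      obtain ⟨d1, d2, d3⟩ := (Finset.mem_filter.1 m1).2
      obtain ⟨κ, hκ, hrel⟩ := walk_rel d1 d2 d3 (a := (walkParams p).1.1)
        (b := (walkParams p).1.2.1) (c := (walkParams p).1.2.2) (d := (walkParams p).2.1)
        (b' := (walkParams p).2.2.1) (c' := (walkParams p).2.2.2) (by
          rintro t (rfl | rfl | rfl)
          · exact mobius_point (nz _ n1.1) (nz _ n2.1) (nz _ n3.1) (nz _ n6.1) (nz _ n4.1)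
              (nz _ n5.1) s1.1 s2.1 s3.1 s4.1 s5.1 s6.1
          · exact mobius_point (nz _ n1.2.1) (nz _ n2.2.1) (nz _ n3.2.1) (nz _ n6.2.1) (nz _ n4.2.1)
              (nz _ n5.2.1) s1.2.1 s2.2.1 s3.2.1 s4.2.1 s5.2.1 s6.2.1
          · exact mobius_point (nz _ n1.2.2) (nz _ n2.2.2) (nz _ n3.2.2) (nz _ n6.2.2) (nz _ n4.2.2)
              (nz _ n5.2.2) s1.2.2 s2.2.2 s3.2.2 s4.2.2 s5.2.2 s6.2.2)
      have hmem : walkParams p ∈ (D ×ˢ D' ×ˢ D) ×ˢ (D' ×ˢ D' ×ˢ D) := by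
        simp only [Finset.mem_product, walkParams]
        exact ⟨⟨Finset.sub_mem_sub n6.1 n5.1, hD'mem _ n6.1 _ n3.1, Finset.sub_mem_sub n3.1 n2.1⟩,
          hD'mem _ n2.1 _ n1.1, hD'mem _ n5.1 _ n4.1, Finset.sub_mem_sub n4.1 n1.1⟩
      have hmem2 : walkParams p ∈ W κ := Finset.mem_filter.2 ⟨hmem, hrel⟩
      rw [Finset.mem_coe, Finset.mem_union]
      rcases hκ with rfl | rfl
      · exact Or.inl hmem2
      · exact Or.inr hmem2
    · intro p hp p' hp' h
      obtain ⟨hp, hpv⟩ := Finset.mem_filter.1 hp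
      obtain ⟨hp', hpv'⟩ := Finset.mem_filter.1 hp'
      obtain ⟨-, ⟨g1, f1⟩, ⟨g2, f2⟩, f3, g3⟩ := hSm p hp
      obtain ⟨-, ⟨g1', f1'⟩, ⟨g2', f2'⟩, f3', g3'⟩ := hSm p' hp'
      simp only [walkParams, Prod.mk.injEq] at h
      obtain ⟨⟨ha, hb, hc⟩, hd, hb', hc'⟩ := h
      have e1 : p.1.1 = p'.1.1 := hpv.trans hpv'.symm
      have e2 := gmap_inj g1 g1' e1 hd
      have e3 := fmap_inj f1 f1' e2 hc
      have e4 := fmap_inj f3 f3' e1 hc'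
      have e5 := gmap_inj g2 g2' e4 hb'
      have e6 := gmap_inj g3 g3' e3 hb
      exact Prod.ext (Prod.ext e1 (Prod.ext e2 e3)) (Prod.ext e4 (Prod.ext e5 e6))
  have hScard : S.card ≤ V.card * (W 1 ∪ W (-1)).card := by
    rw [Finset.card_eq_sum_card_fiberwise (f := fun p => p.1.1) (t := V)
      (fun p hp => (hSm p hp).1.1), ← smul_eq_mul]
    exact Finset.sum_le_card_nsmul _ _ _ hfib
  have hu := Finset.card_union_le (W 1) (W (-1))
  have hlow := card_distinctTriples X h6
  have hup := card_distinctTriples_le X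
  rw [← hV] at hlow hup
  rw [Finset.card_product, Finset.card_product, hD'c] at hwalk
  push_cast at hwalk
  have hmain := walk_arith hn hM1 (Nat.cast_nonneg D.card) hD (Nat.cast_nonneg V.card) hlow hup
    (Nat.cast_nonneg _) (w := (((W 1 ∪ W (-1)).card : ℕ) : ℝ)) (by exact_mod_cast hScard)
    (w' := (((W 1).card : ℕ) : ℝ) + (((W (-1)).card : ℕ) : ℝ)) (by exact_mod_cast hu) hwalk
  clear hwalk hS hSm hfib hScard hu hlow hup hW
  generalize hw1 : (W 1).card = w1 at *
  generalize hw2 : (W (-1)).card = w2 at *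
  by_cases hcmp : w1 ≤ w2
  · refine ⟨-1, Or.inr rfl, hmain.trans ?_⟩
    rw [hw2]
    have : (w1 : ℝ) ≤ w2 := by exact_mod_cast hcmp
    calc _ ≤ 2 ^ 6 * M ^ 24 * ((w2 : ℝ) + w2) := by gcongr
      _ = _ := by ring
  · refine ⟨1, Or.inl rfl, hmain.trans ?_⟩
    rw [hw1]
    have : (w2 : ℝ) ≤ w1 := by exact_mod_cast (not_le.1 hcmp).le
    calc _ ≤ 2 ^ 6 * M ^ 24 * ((w1 : ℝ) + w1) := by gcongr
      _ = _ := by ring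

theorem theta_arith {n M Q d th : ℝ} (hn : 0 < n) (hM1 : 1 ≤ M) (hD : d ≤ M ^ 2 * n)
    (hth : 0 ≤ th) (hQbig : n ^ 2 ≤ 2 ^ 8 * M ^ 26 * Q)
    (h1 : Q ≤ th * (M ^ 2 * n) + d * (n / (2 ^ 9 * M ^ 28))) : n ≤ 2 ^ 9 * M ^ 28 * th := by
  have hM0 : 0 < M := by linarith
  have h2 : n ^ 2 ≤ 2 ^ 8 * M ^ 26 * (th * (M ^ 2 * n)) + n ^ 2 / 2 := by
    calc n ^ 2 ≤ 2 ^ 8 * M ^ 26 * Q := hQbig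
      _ ≤ 2 ^ 8 * M ^ 26 * (th * (M ^ 2 * n) + (M ^ 2 * n) * (n / (2 ^ 9 * M ^ 28))) := by
        gcongr
        refine h1.trans ?_
        gcongr
      _ = _ := by field_simp
  have h3 : n * n ≤ n * (2 ^ 9 * M ^ 28 * th) := by nlinarith
  exact le_of_mul_le_mul_left h3 hn

set_option maxHeartbeats 1000000 in
theorem exists_theta {X : Finset F} {α : F} (hα : α ≠ 0) (h0 : (0 : F) ∉ X)
    (hinv : ∀ x ∈ X, α * x⁻¹ ∈ X) {M : ℝ}
    (hM : ((X + X).card : ℝ) ≤ M * X.card) (hM1 : 1 ≤ M) (hbig : 2 ^ 10 * M ^ 28 ≤ X.card) :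
    ∃ κ : F, (κ = 1 ∨ κ = -1) ∧ ∃ b0 : F, b0 ≠ 0 ∧ ∃ Θ ⊆ X - X,
      (X.card : ℝ) ≤ 2 ^ 9 * M ^ 28 * Θ.card ∧
      ∀ c ∈ Θ, ∃ S ⊆ X - X, (X.card : ℝ) ≤ 2 ^ 9 * M ^ 28 * S.card ∧
        ∀ s ∈ S, ∃ a ∈ X - X, 1 + c * (α⁻¹ * s) = κ * (1 + a * b0) := by
  have hM28 : (1 : ℝ) ≤ M ^ 28 := one_le_pow₀ hM1
  have hM0 : 0 < M := by linarith
  have hn1 : (1024 : ℝ) ≤ X.card := by linarith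
  have h6 : 6 ≤ X.card := by
    have : (6 : ℝ) ≤ X.card := by linarith
    exact_mod_cast this
  have hne : X.Nonempty := Finset.card_pos.1 (by omega)
  have hn : (0 : ℝ) < X.card := by linarith
  have hD : ((X - X).card : ℝ) ≤ M ^ 2 * X.card := by
    have := pr_ineq hne hM 1 1
    simpa using this
  obtain ⟨κ, hκ, hW⟩ := walk_count hα h0 hinv hM hM1 h6
  have hDne : (X - X).Nonempty := hne.sub hne
  set D := X - X with hDdef
  set D' := α⁻¹ • D with hD'def
  have hD'c : D'.card = D.card := Finset.card_smul_finset₀ (inv_ne_zero hα) _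
  have hP := param_count D D' D.card le_rfl hD'c.le κ hκ
  set P := (D' ×ˢ D ×ˢ D').filter fun t : F × F × F =>
      t.1 ≠ 0 ∧ ∃ a ∈ D, 1 + t.2.1 * t.2.2 = κ * (1 + a * t.1) with hPdef
  have hPm : ∀ t ∈ P, (t.1 ∈ D' ∧ t.2.1 ∈ D ∧ t.2.2 ∈ D') ∧ t.1 ≠ 0 ∧
      ∃ a ∈ D, 1 + t.2.1 * t.2.2 = κ * (1 + a * t.1) := by
    intro t ht
    have := Finset.mem_filter.1 ht
    simpa only [Finset.mem_product] using this
  generalize (((D ×ˢ D' ×ˢ D) ×ˢ (D' ×ˢ D' ×ˢ D)).filter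
        fun t : (F × F × F) × (F × F × F) =>
        WalkRel κ t.1.1 t.1.2.1 t.1.2.2 t.2.1 t.2.2.1 t.2.2.2).card = w at hW hP
  clear_value P D
  have hP' : (w : ℝ) ≤ 3 * (D.card : ℝ) ^ 2 + P.card := by exact_mod_cast hP
  set n : ℝ := (X.card : ℝ) with hndef
  have hPbig : n ^ 3 ≤ 2 ^ 8 * M ^ 24 * P.card := by
    have h1 : n ^ 3 ≤ 2 ^ 7 * M ^ 24 * (3 * (M ^ 2 * n) ^ 2 + P.card) := by
      refine hW.trans ?_
      gcongr
      exact hP'.trans (by gcongr)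
    have h2 : (2 ^ 10 * M ^ 28) * n ^ 2 ≤ n * n ^ 2 := by gcongr
    have h3 : 0 ≤ n ^ 3 := by positivity
    have h4 : n ^ 3 ≤ 384 * M ^ 28 * n ^ 2 + 2 ^ 7 * M ^ 24 * P.card := h1.trans (le_of_eq (by ring))
    linarith
  -- fix b0
  have hD0 : (0 : ℝ) < D.card := by exact_mod_cast hDne.card_pos
  have hsum1 := Finset.card_eq_sum_card_fiberwise (s := P) (f := fun t => t.1) (t := D')
    (fun t ht => (hPm t ht).1.1)
  have hD'ne : D'.Nonempty := Finset.card_pos.1 (by rw [hD'c]; exact hDne.card_pos)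
  obtain ⟨b0, hb0, hfib⟩ := Finset.exists_le_of_sum_le (s := D') (f := fun _ => (P.card : ℝ) / D.card)
    (g := fun b => ((P.filter fun t : F × F × F => t.1 = b).card : ℝ)) hD'ne (by
      rw [Finset.sum_const, nsmul_eq_mul, hD'c, mul_div_cancel₀ _ hD0.ne']
      exact_mod_cast hsum1.le)
  set Q := P.filter fun t => t.1 = b0 with hQ
  have hQm : ∀ t ∈ Q, t ∈ P ∧ t.1 = b0 := fun t ht => Finset.mem_filter.1 ht
  clear_value Q
  have hfib' : (P.card : ℝ) ≤ Q.card * (M ^ 2 * n) := by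
    rw [div_le_iff₀ hD0] at hfib
    exact hfib.trans (by gcongr)
  have hQbig : n ^ 2 ≤ 2 ^ 8 * M ^ 26 * Q.card := by
    have h1 : n * n ^ 2 ≤ n * (2 ^ 8 * M ^ 26 * Q.card) := by
      calc n * n ^ 2 = n ^ 3 := by ring
        _ ≤ _ := hPbig
        _ ≤ 2 ^ 8 * M ^ 24 * (Q.card * (M ^ 2 * n)) := by gcongr
        _ = _ := by ring
    exact le_of_mul_le_mul_left h1 hn
  have hb00 : b0 ≠ 0 := by
    have : 0 < Q.card := by
      rcases Nat.eq_zero_or_pos Q.card with h | h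
      · rw [h] at hQbig
        have : 0 < n ^ 2 := by positivity
        simp at hQbig
        linarith
      · exact h
    obtain ⟨t, ht⟩ := Finset.card_pos.1 this
    obtain ⟨h1, h2⟩ := hQm t ht
    exact h2 ▸ (hPm t h1).2.1
  have hS : ∀ c, ∃ S ⊆ D, S.card = (Q.filter fun t => t.2.1 = c).card ∧
      ∀ s ∈ S, ∃ a ∈ D, 1 + c * (α⁻¹ * s) = κ * (1 + a * b0) := by
    intro c
    refine ⟨(Q.filter fun t => t.2.1 = c).image fun t => α * t.2.2, ?_, ?_, ?_⟩
    · intro s hs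
      obtain ⟨t, ht, rfl⟩ := Finset.mem_image.1 hs
      have h1 := (hPm t (hQm t (Finset.mem_filter.1 ht).1).1).1.2.2
      obtain ⟨y, hy, h2⟩ := Finset.mem_smul_finset.1 h1
      rw [← h2, smul_eq_mul, mul_inv_cancel_left₀ hα]
      exact hy
    · refine Finset.card_image_of_injOn ?_
      intro t ht t' ht' h
      obtain ⟨h1, h2⟩ := Finset.mem_filter.1 ht
      obtain ⟨h1', h2'⟩ := Finset.mem_filter.1 ht'
      exact Prod.ext ((hQm t h1).2.trans (hQm t' h1').2.symm)
        (Prod.ext (h2.trans h2'.symm) (mul_left_cancel₀ hα h))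
    · intro s hs
      obtain ⟨t, ht, rfl⟩ := Finset.mem_image.1 hs
      obtain ⟨h1, h2⟩ := Finset.mem_filter.1 ht
      obtain ⟨a, ha, h3⟩ := (hPm t (hQm t h1).1).2.2
      refine ⟨a, ha, ?_⟩
      rw [inv_mul_cancel_left₀ hα, ← h2, ← (hQm t h1).2]
      exact h3
  refine ⟨κ, hκ, b0, hb00,
    D.filter (fun c => n ≤ 2 ^ 9 * M ^ 28 * ((Q.filter fun t => t.2.1 = c).card : ℝ)),
    Finset.filter_subset _ _, ?_, ?_⟩
  · set Θ := D.filter (fun c => n ≤ 2 ^ 9 * M ^ 28 * ((Q.filter fun t => t.2.1 = c).card : ℝ)) with hΘ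
    have hsum2 := Finset.card_eq_sum_card_fiberwise (s := Q) (f := fun t => t.2.1) (t := D)
      (fun t ht => (hPm t (hQm t ht).1).1.2.1)
    have hsum3 : (Q.card : ℝ) = ∑ c ∈ D, ((Q.filter fun t => t.2.1 = c).card : ℝ) := by
      exact_mod_cast hsum2
    have hle : ∀ c ∈ D, ((Q.filter fun t => t.2.1 = c).card : ℝ) ≤
        (if n ≤ 2 ^ 9 * M ^ 28 * ((Q.filter fun t => t.2.1 = c).card : ℝ) then M ^ 2 * n else 0)
          + n / (2 ^ 9 * M ^ 28) := by
      intro c _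
      split_ifs with h
      · obtain ⟨S, hS1, hS2, _⟩ := hS c
        rw [← hS2]
        have h1 : (S.card : ℝ) ≤ D.card := by exact_mod_cast Finset.card_le_card hS1
        have h2 : 0 ≤ n / (2 ^ 9 * M ^ 28) := by positivity
        linarith
      · rw [zero_add, le_div_iff₀ (by positivity)]
        linarith
    have h1 := Finset.sum_le_sum hle
    rw [← hsum3, Finset.sum_add_distrib, ← Finset.sum_filter, Finset.sum_const, Finset.sum_const,
      nsmul_eq_mul, nsmul_eq_mul, ← hΘ] at h1
    exact theta_arith hn hM1 hD (Nat.cast_nonneg _) hQbig h1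
  · intro c hc
    obtain ⟨S, hS1, hS2, hS3⟩ := hS c
    refine ⟨S, hS1, ?_, hS3⟩
    rw [hS2]
    exact (Finset.mem_filter.1 hc).2

theorem goodDil_of_rel {X : Finset F} {α : F} (hα : α ≠ 0) (hne : X.Nonempty) {M : ℝ}
    (hM : ((X + X).card : ℝ) ≤ M * X.card) (hM1 : 1 ≤ M) {κ b0 c : F} (hκ : κ = 1 ∨ κ = -1)
    (hb0 : b0 ≠ 0) (S : Finset F) (hSD : S ⊆ X - X)
    (hS : (X.card : ℝ) ≤ 2 ^ 9 * M ^ 28 * S.card)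
    (hrel : ∀ s ∈ S, ∃ a ∈ X - X, 1 + c * (α⁻¹ * s) = κ * (1 + a * b0)) :
    GoodDil X (2 ^ 9 * M ^ 34) (c / (α * b0)) := by
  have hM0 : 0 < M := by linarith
  have hn : (0 : ℝ) < X.card := by exact_mod_cast hne.card_pos
  have hL : (1 : ℝ) ≤ 2 ^ 9 * M ^ 34 :=
    one_le_mul_of_one_le_of_one_le (by norm_num) (one_le_pow₀ hM1)
  by_cases hc : c = 0
  · rw [hc, zero_div]
    exact goodDil_zero hne hL
  set l := c / (α * b0) with hl
  have hl0 : l ≠ 0 := div_ne_zero hc (mul_ne_zero hα hb0)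
  have hpr : ((X + (X - X)).card : ℝ) ≤ M ^ 3 * X.card := by
    have := pr_ineq hne hM 2 1
    rw [two_nsmul, one_nsmul, ← add_sub_assoc] at *
    exact this
  have h1 : ((X + l • S).card : ℝ) ≤ M ^ 3 * X.card := by
    refine le_trans ?_ hpr
    have hsub : X + l • S ⊆ (X + (X - X)).image fun y => y + (κ - 1) / b0 := by
      intro y hy
      obtain ⟨x, hx, z, hz, rfl⟩ := Finset.mem_add.1 hy
      obtain ⟨s, hs, rfl⟩ := Finset.mem_smul_finset.1 hz
      obtain ⟨a, ha, h⟩ := hrel s hs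
      refine Finset.mem_image.2 ⟨x + κ * a, Finset.add_mem_add hx ?_, ?_⟩
      · rcases hκ with rfl | rfl
        · rwa [one_mul]
        · obtain ⟨u, hu, v, hv, rfl⟩ := Finset.mem_sub.1 ha
          exact Finset.mem_sub.2 ⟨v, hv, u, hu, by ring⟩
      · have e : l • s = κ * a + (κ - 1) / b0 := by
          rw [smul_eq_mul, hl]
          field_simp at h ⊢
          linear_combination h
        rw [e]; ring
    exact_mod_cast (Finset.card_le_card hsub).trans Finset.card_image_le
  have h2 : ((l • S + l • X).card : ℝ) ≤ M ^ 3 * X.card := by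
    refine le_trans ?_ hpr
    rw [← smul_add, Finset.card_smul_finset₀ hl0, add_comm S X]
    exact_mod_cast Finset.card_le_card (Finset.add_subset_add_left hSD)
  have h3 := Finset.ruzsa_triangle_inequality_add_add_add X (l • S) (l • X)
  rw [Finset.card_smul_finset₀ hl0 S] at h3
  have h4 : ((X + l • X).card : ℝ) * S.card ≤ (M ^ 3 * X.card) * (M ^ 3 * X.card) := by
    calc ((X + l • X).card : ℝ) * S.card ≤ (X + l • S).card * (l • S + l • X).card := by
          exact_mod_cast h3
      _ ≤ _ := by gcongr
  unfold GoodDil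
  have h5 : (X.card : ℝ) * (X + l • X).card ≤ X.card * (2 ^ 9 * M ^ 34 * X.card) := by
    calc (X.card : ℝ) * (X + l • X).card ≤ 2 ^ 9 * M ^ 28 * S.card * (X + l • X).card := by gcongr
      _ = 2 ^ 9 * M ^ 28 * (((X + l • X).card : ℝ) * S.card) := by ring
      _ ≤ 2 ^ 9 * M ^ 28 * ((M ^ 3 * X.card) * (M ^ 3 * X.card)) := by gcongr
      _ = _ := by ring
  exact le_of_mul_le_mul_left h5 hn

theorem core [Finite F] {X : Finset F} {α : F} (hα : α ≠ 0) (h0 : (0 : F) ∉ X)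
    (hinv : ∀ x ∈ X, α * x⁻¹ ∈ X) {M : ℝ}
    (hM : ((X + X).card : ℝ) ≤ M * X.card) (hM1 : 1 ≤ M) (hbig : 2 ^ 110 * M ^ 438 ≤ X.card) :
    ∃ G : Subfield F, ∃ c0 : F, c0 ≠ 0 ∧ (Nat.card G : ℝ) ≤ 2 ^ 37 * M ^ 152 * X.card ∧
      (X.card : ℝ) ≤ 2 * (X.filter fun x => ∃ g ∈ G, x = c0 * g).card := by
  have hM0 : 0 < M := by linarith
  have hmono : ∀ i j : ℕ, i ≤ 110 → j ≤ 438 → (2 : ℝ) ^ i * M ^ j ≤ X.card := by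
    intro i j hi hj
    refine le_trans ?_ hbig
    gcongr
    norm_num
  have hn : (0 : ℝ) < X.card := lt_of_lt_of_le (by positivity) hbig
  have hne : X.Nonempty := Finset.card_pos.1 (by exact_mod_cast hn)
  obtain ⟨κ, hκ, b0, hb0, Θ, hΘD, hΘ, hrel⟩ := exists_theta hα h0 hinv hM hM1
    (hmono 10 28 (by norm_num) (by norm_num))
  have hab : α * b0 ≠ 0 := mul_ne_zero hα hb0
  have hL : (1 : ℝ) ≤ 2 ^ 9 * M ^ 34 :=
    one_le_mul_of_one_le_of_one_le (by norm_num) (one_le_pow₀ hM1)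
  set Θ' := Θ.image fun c => c / (α * b0) with hΘ'
  have hc' : Θ'.card = Θ.card := Finset.card_image_of_injective _ (fun _ _ h => (div_left_inj' hab).1 h)
  have hgood : ∀ t ∈ Θ', GoodDil X (2 ^ 9 * M ^ 34) t := by
    intro t ht
    obtain ⟨c, hc, rfl⟩ := Finset.mem_image.1 ht
    obtain ⟨S, hSD, hS, hr⟩ := hrel c hc
    exact goodDil_of_rel hα hne hM hM1 hκ hb0 S hSD hS hr
  have e1 : ((2 : ℝ) ^ 9 * M ^ 34) ^ 10 * M ^ 42 = 2 ^ 90 * M ^ 382 := by ring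
  have hΘbig : 2 * (2 ^ 90 * M ^ 382) * (X.card : ℝ) < (Θ.card : ℝ) ^ 2 := by
    have h1 : (X.card : ℝ) ^ 2 ≤ 2 ^ 18 * M ^ 56 * (Θ.card : ℝ) ^ 2 := by
      calc (X.card : ℝ) ^ 2 ≤ (2 ^ 9 * M ^ 28 * Θ.card) ^ 2 := by gcongr
        _ = _ := by ring
    have h2 : 2 ^ 18 * M ^ 56 * (2 * (2 ^ 90 * M ^ 382) * (X.card : ℝ)) <
        2 ^ 18 * M ^ 56 * (Θ.card : ℝ) ^ 2 := by
      refine lt_of_lt_of_le ?_ h1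
      calc 2 ^ 18 * M ^ 56 * (2 * (2 ^ 90 * M ^ 382) * (X.card : ℝ)) =
            2 ^ 109 * M ^ 438 * X.card := by ring
        _ < 2 ^ 110 * M ^ 438 * X.card := by gcongr <;> norm_num
        _ ≤ X.card * X.card := by gcongr
        _ = _ := by ring
    exact lt_of_mul_lt_mul_left h2 (by positivity)
  have hΘ2 : 1 < Θ.card := by
    have h1 : (2 : ℝ) ^ 10 * M ^ 28 ≤ 2 ^ 9 * M ^ 28 * Θ.card :=
      (hmono 10 28 (by norm_num) (by norm_num)).trans hΘ
    have h2 : (2 : ℝ) ≤ Θ.card := by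
      have h3 : 2 ^ 9 * M ^ 28 * (2 : ℝ) ≤ 2 ^ 9 * M ^ 28 * Θ.card := by linarith
      exact le_of_mul_le_mul_left h3 (by positivity)
    exact_mod_cast h2
  obtain ⟨G, hG, hGgood⟩ := exists_subfield hne hM hM1 hL Θ' hgood (by rw [hc']; exact hΘ2) (by
      rw [e1]
      refine le_trans (le_of_eq ?_) (hmono 91 382 (by norm_num) (by norm_num))
      ring) (by
      rw [e1, hc']; exact hΘbig)
  obtain ⟨u, hu, v, hv, huv⟩ := Finset.one_lt_card.1 hΘ2
  have hdiff : ∀ s ∈ Θ, ∀ t ∈ Θ, ∃ g ∈ G, s - t = (u - v) * g := by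
    intro s hs t ht
    refine ⟨(s - t) / (u - v), (hG _).2 ⟨s / (α * b0), Finset.mem_image_of_mem _ hs, t / (α * b0),
      Finset.mem_image_of_mem _ ht, u / (α * b0), Finset.mem_image_of_mem _ hu, v / (α * b0),
      Finset.mem_image_of_mem _ hv, fun h => huv ((div_left_inj' hab).1 h), ?_⟩, ?_⟩
    · rw [← sub_div, ← sub_div, div_div_div_cancel_right₀ hab]
    · rw [mul_div_cancel₀ _ (sub_ne_zero.2 huv)]
  have hpr : ((X + (X - X)).card : ℝ) ≤ M ^ 3 * X.card := by
    have := pr_ineq hne hM 2 1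
    rw [two_nsmul, one_nsmul, ← add_sub_assoc] at *
    exact this
  obtain ⟨T, -, hT1, hT2⟩ := Finset.ruzsa_covering_add (A := X) (B := Θ) (K := 2 ^ 9 * M ^ 31)
    ⟨u, hu⟩ (by
      calc ((X + Θ).card : ℝ) ≤ (X + (X - X)).card := by
            exact_mod_cast Finset.card_le_card (Finset.add_subset_add_left hΘD)
        _ ≤ M ^ 3 * X.card := hpr
        _ ≤ M ^ 3 * (2 ^ 9 * M ^ 28 * Θ.card) := by gcongr
        _ = _ := by ring)
  have hdense := dense_in_dilate hα h0 hinv G (sub_ne_zero.2 huv) T (by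
    intro x hx
    obtain ⟨t, ht, y, hy, rfl⟩ := Finset.mem_add.1 (hT2 hx)
    obtain ⟨s, hs, s', hs', rfl⟩ := Finset.mem_sub.1 hy
    obtain ⟨g, hg, h⟩ := hdiff s hs s' hs'
    exact ⟨t, ht, g, hg, by rw [h]⟩)
  refine ⟨G, u - v, sub_ne_zero.2 huv, ?_, ?_⟩
  · have : Fintype F := Fintype.ofFinite F
    have e2 : ((2 : ℝ) ^ 9 * M ^ 34) ^ 4 * M ^ 16 = 2 ^ 36 * M ^ 152 := by ring
    have := goodDil_card hne (L := 2 ^ 36 * M ^ 152)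
      (one_le_mul_of_one_le_of_one_le (by norm_num) (one_le_pow₀ hM1))
      (by
        refine le_trans (le_of_eq ?_) (hmono 37 152 (by norm_num) (by norm_num))
        ring) (Finset.univ.filter fun x => x ∈ G) (by
        intro r hr
        rw [← e2]
        exact hGgood r (Finset.mem_filter.1 hr).2)
    have e3 : Nat.card G = (Finset.univ.filter fun x => x ∈ G).card := by
      rw [Nat.card_eq_fintype_card]
      exact Fintype.card_subtype _
    rw [e3]
    refine this.trans (le_of_eq ?_)
    ring
  · have h1 : (X.card : ℝ) ≤ (X.filter fun x => ∃ g ∈ G, x = (u - v) * g).card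
        + 2 * (T.card : ℝ) ^ 2 := by exact_mod_cast hdense
    have h2 : 2 * (T.card : ℝ) ^ 2 ≤ X.card / 2 := by
      have h3 : 2 * (T.card : ℝ) ^ 2 ≤ 2 * (2 ^ 9 * M ^ 31) ^ 2 := by gcongr
      have h4 := hmono 20 62 (by norm_num) (by norm_num)
      have h5 : 2 * ((2 : ℝ) ^ 9 * M ^ 31) ^ 2 = 2 ^ 20 * M ^ 62 / 2 := by ring
      linarith
    linarith

theorem rpow_pow_cancel {K a : ℝ} (hK : 0 ≤ K) (n m : ℕ) (h : a * n = m) :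
    (K ^ a) ^ n = K ^ m := by
  rw [← Real.rpow_natCast, ← Real.rpow_mul hK, h, Real.rpow_natCast]

theorem final_bounds {n K q B : ℝ} (hn : 0 < n) (hK : 0 < K) (hq : 0 < q) (hB : 2 ≤ B)
    (h : B * (K ^ ((1:ℝ) - 1/832) + q ^ (-(1:ℝ)/760) * K ^ ((1:ℝ) + 1/760)) < n) :
    B ^ 832 * (K / n) ^ 831 < n ∧ B ^ 760 * (K / n) ^ 760 * K < q := by
  have p1 : 0 < K ^ ((1:ℝ) - 1/832) := Real.rpow_pos_of_pos hK _
  have p2 : 0 < q ^ (-(1:ℝ)/760) := Real.rpow_pos_of_pos hq _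
  have p3 : 0 < K ^ ((1:ℝ) + 1/760) := Real.rpow_pos_of_pos hK _
  have p4 : 0 < q ^ (-(1:ℝ)/760) * K ^ ((1:ℝ) + 1/760) := mul_pos p2 p3
  have hB0 : 0 < B := by linarith
  have h1 : B * K ^ ((1:ℝ) - 1/832) < n := by nlinarith
  have h2 : B * (q ^ (-(1:ℝ)/760) * K ^ ((1:ℝ) + 1/760)) < n := by nlinarith
  constructor
  · have e := pow_lt_pow_left₀ h1 (by positivity) (n := 832) (by norm_num)
    rw [mul_pow, rpow_pow_cancel hK.le 832 831 (by norm_num)] at e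
    rw [div_pow, ← mul_div_assoc, div_lt_iff₀ (by positivity)]
    calc B ^ 832 * K ^ 831 < n ^ 832 := e
      _ = n * n ^ 831 := by rw [← pow_succ']
  · have e := pow_lt_pow_left₀ h2 (by positivity) (n := 760) (by norm_num)
    have e2 : (q ^ (-(1:ℝ)/760)) ^ 760 = q⁻¹ := by
      rw [← Real.rpow_natCast, ← Real.rpow_mul hq.le,
        show (-(1:ℝ)/760) * (760 : ℕ) = -1 by norm_num, Real.rpow_neg_one]
    rw [mul_pow, mul_pow, rpow_pow_cancel hK.le 760 761 (by norm_num), e2] at e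
    rw [div_pow, ← mul_div_assoc, div_mul_eq_mul_div, div_lt_iff₀ (by positivity)]
    calc B ^ 760 * K ^ 760 * K = q * (B ^ 760 * (q⁻¹ * K ^ 761)) := by
          rw [pow_succ K 760]; field_simp
      _ < q * n ^ 760 := by gcongr

theorem final_sqrt {n M g B : ℝ} (hn : 0 < n) (hM1 : 1 ≤ M) (hB : 2 ≤ B) (hg0 : 0 ≤ g)
    (hg : g ≤ 2 ^ 37 * M ^ 152 * n) (h1 : B ^ 832 * M ^ 831 < n)
    (h : n ≤ B * g ^ ((1:ℝ)/2)) : False := by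
  have hB0 : 0 < B := by linarith
  have hM0 : 0 < M := by linarith
  have e : (g ^ ((1:ℝ)/2)) ^ 2 = g := by
    have := rpow_pow_cancel hg0 2 1 (a := (1:ℝ)/2) (by norm_num)
    rwa [pow_one] at this
  have h2 : n * n ≤ n * (B ^ 832 * M ^ 831) := by
    calc n * n = n ^ 2 := by ring
      _ ≤ (B * g ^ ((1:ℝ)/2)) ^ 2 := by gcongr
      _ = B ^ 2 * g := by rw [mul_pow, e]
      _ ≤ B ^ 2 * (2 ^ 37 * M ^ 152 * n) := by gcongr
      _ ≤ B ^ 2 * (B ^ 37 * M ^ 152 * n) := by gcongr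
      _ = n * (B ^ 39 * M ^ 152) := by ring
      _ ≤ n * (B ^ 832 * M ^ 831) := by
        gcongr <;> first | linarith | norm_num
  exact absurd (le_of_mul_le_mul_left h2 hn) (not_le.2 h1)

theorem final_pow {n K B : ℝ} (hn : 0 < n) (hK : 0 < K) (hM1 : 1 ≤ K / n) (hB : 2 ≤ B)
    (h1 : B ^ 832 * (K / n) ^ 831 < n) (h : n ≤ B * K ^ ((47:ℝ)/48)) : False := by
  have hB0 : 0 < B := by linarith
  have h2 : n ≤ B ^ 48 * (K / n) ^ 47 := by
    have e := pow_le_pow_left₀ hn.le h 48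
    rw [mul_pow, rpow_pow_cancel hK.le 48 47 (by norm_num)] at e
    rw [div_pow, ← mul_div_assoc, le_div_iff₀ (by positivity)]
    calc n * n ^ 47 = n ^ 48 := by ring
      _ ≤ _ := e
  have h3 : B ^ 48 * (K / n) ^ 47 ≤ B ^ 832 * (K / n) ^ 831 := by
    gcongr <;> first | linarith | norm_num
  linarith

theorem final_core [Finite F] {C : ℝ} (hC : 0 < C) (A : Finset F) (h0 : (0 : F) ∉ A)
    (h0' : (0 : F) ∉ A + A)
    (hsub : subfieldCond (A + A)⁻¹ C (((A + A).card : ℝ) ^ ((47:ℝ)/48)))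
    (X : Finset F) (hXA : X ⊆ A) (hXne : X.Nonempty) {α : F} (hα : α ≠ 0)
    (hinv : ∀ x ∈ X, α * x⁻¹ ∈ X) {B : ℝ} (hB : 2 ≤ B) (hBC : 2 * C ≤ B)
    (h1 : B ^ 832 * (((A + A).card : ℝ) / X.card) ^ 831 < X.card)
    (h2 : B ^ 760 * (((A + A).card : ℝ) / X.card) ^ 760 * (A + A).card < Nat.card F) : False := by
  have hn : (0 : ℝ) < X.card := by exact_mod_cast hXne.card_pos
  have hXX : ((X + X).card : ℝ) ≤ (A + A).card := by
    exact_mod_cast Finset.card_le_card (Finset.add_subset_add hXA hXA)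
  have hnK : (X.card : ℝ) ≤ (A + A).card := by
    have : X.card ≤ (X + X).card := Finset.card_le_card_add_right hXne
    exact le_trans (by exact_mod_cast this) hXX
  have hK : (0 : ℝ) < (A + A).card := hn.trans_le hnK
  have hM1 : 1 ≤ ((A + A).card : ℝ) / X.card := (one_le_div hn).2 hnK
  set M := ((A + A).card : ℝ) / X.card with hMdef
  have hMn : M * X.card = (A + A).card := div_mul_cancel₀ _ hn.ne'
  have hM0 : 0 < M := by linarith
  have hB0 : 0 < B := by linarith
  have h0X : (0 : F) ∉ X := fun h => h0 (hXA h)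
  obtain ⟨G, c0, hc0, hG, hY⟩ := core hα h0X hinv (M := M) (by rw [hMn]; exact hXX) hM1 (by
    refine le_trans ?_ h1.le
    calc (2 : ℝ) ^ 110 * M ^ 438 ≤ B ^ 110 * M ^ 438 := by gcongr
      _ ≤ B ^ 832 * M ^ 831 := by gcongr <;> first | linarith | norm_num)
  by_cases hT : G = ⊤
  · have e : Nat.card G = Nat.card F := by
      rw [hT]
      exact Nat.card_congr Subfield.topEquiv.toEquiv
    rw [e] at hG
    have h3 : (2 : ℝ) ^ 37 * M ^ 152 * X.card ≤ B ^ 760 * M ^ 760 * (A + A).card := by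
      calc (2 : ℝ) ^ 37 * M ^ 152 * X.card ≤ B ^ 37 * M ^ 152 * (A + A).card := by gcongr
        _ ≤ _ := by gcongr <;> first | linarith | norm_num
    linarith
  · have hs := hsub G hT c0⁻¹ 0
    set Y := X.filter fun x => ∃ g ∈ G, x = c0 * g with hYdef
    have hYpos : 0 < Y.card := by
      have : (0 : ℝ) < Y.card := by linarith
      exact_mod_cast this
    obtain ⟨x0, hx0⟩ := Finset.card_pos.1 hYpos
    obtain ⟨hx0X, g0, hg0, hx0g⟩ := Finset.mem_filter.1 hx0
    have hle : Y.card ≤ ((A + A)⁻¹.filter fun x => ∃ g ∈ G, x = c0⁻¹ * g + 0).card := by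
      refine Finset.card_le_card_of_injOn (fun x => (x + x0)⁻¹) ?_ ?_
      · intro x hx
        obtain ⟨hxX, g, hg, hxg⟩ := Finset.mem_filter.1 hx
        refine Finset.mem_filter.2 ⟨Finset.inv_mem_inv (Finset.add_mem_add (hXA hxX) (hXA hx0X)),
          (g + g0)⁻¹, G.inv_mem (G.add_mem hg hg0), ?_⟩
        show (x + x0)⁻¹ = c0⁻¹ * (g + g0)⁻¹ + 0
        rw [add_zero, hxg, hx0g, ← mul_add, mul_inv]
      · intro x _ y _ h
        exact add_right_cancel (inv_inj.1 h)
    have hle' : (Y.card : ℝ) ≤ C * max ((Nat.card G : ℝ) ^ ((1:ℝ)/2))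
        (((A + A).card : ℝ) ^ ((47:ℝ)/48)) := by
      refine le_trans ?_ hs
      exact_mod_cast hle
    have hm0 : 0 ≤ max ((Nat.card G : ℝ) ^ ((1:ℝ)/2)) (((A + A).card : ℝ) ^ ((47:ℝ)/48)) :=
      le_max_of_le_left (by positivity)
    have hfin : (X.card : ℝ) ≤ B * max ((Nat.card G : ℝ) ^ ((1:ℝ)/2))
        (((A + A).card : ℝ) ^ ((47:ℝ)/48)) := by
      nlinarith
    rcases max_choice ((Nat.card G : ℝ) ^ ((1:ℝ)/2)) (((A + A).card : ℝ) ^ ((47:ℝ)/48)) with h | h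
    · rw [h] at hfin
      exact final_sqrt hn hM1 hB (Nat.cast_nonneg _) hG h1 hfin
    · rw [h] at hfin
      exact final_pow hn hK hM1 hB h1 hfin

theorem stmt11 : ∀ C : ℝ, 0 < C → ∃ C' : ℝ, 0 < C' ∧
    ∀ (F : Type) [Field F] [Fintype F] (q : ℕ), IsPrimePow q → Fintype.card F = q →
    ∀ A : Finset F, 2 ≤ A.card → (0:F) ∉ A → (0:F) ∉ A + A →
    subfieldCond (A + A)⁻¹ C (((A + A).card : ℝ) ^ ((47:ℝ)/48)) →
    ∀ α : F, α ≠ 0 →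
    ((A ∩ A.image fun a => α * a⁻¹).card : ℝ) ≤
      C' * (((A + A).card : ℝ) ^ ((1:ℝ) - 1/832)
        + (q : ℝ) ^ (-(1:ℝ)/760) * (((A + A).card : ℝ)) ^ ((1:ℝ) + 1/760)) := by
  intro C hC
  refine ⟨2 * (1 + C), by linarith, ?_⟩
  intro F _ _ q hq hcard A _ h0 h0' hsub α hα
  by_contra hlt
  replace hlt := not_le.1 hlt
  set X := A ∩ A.image fun a => α * a⁻¹ with hX
  have hRnonneg : 0 ≤ 2 * (1 + C) * (((A + A).card : ℝ) ^ ((1:ℝ) - 1/832)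
        + (q : ℝ) ^ (-(1:ℝ)/760) * (((A + A).card : ℝ)) ^ ((1:ℝ) + 1/760)) := by positivity
  have hn : (0 : ℝ) < X.card := lt_of_le_of_lt hRnonneg hlt
  have hXne : X.Nonempty := Finset.card_pos.1 (by exact_mod_cast hn)
  have hXA : X ⊆ A := Finset.inter_subset_left
  have hK : (0 : ℝ) < (A + A).card := by
    obtain ⟨x, hx⟩ := hXne
    exact_mod_cast Finset.card_pos.2 ⟨x + x, Finset.add_mem_add (hXA hx) (hXA hx)⟩
  have hq0 : (0 : ℝ) < q := by exact_mod_cast hq.pos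
  have hinv : ∀ x ∈ X, α * x⁻¹ ∈ X := by
    intro x hx
    obtain ⟨h1, h2⟩ := Finset.mem_inter.1 hx
    obtain ⟨a, ha, rfl⟩ := Finset.mem_image.1 h2
    refine Finset.mem_inter.2 ⟨?_, Finset.mem_image_of_mem _ h1⟩
    have : α * (α * a⁻¹)⁻¹ = a := by
      rw [mul_inv, inv_inv, mul_inv_cancel_left₀ hα]
    rwa [this]
  obtain ⟨b1, b2⟩ := final_bounds hn hK hq0 (by linarith : (2 : ℝ) ≤ 2 * (1 + C)) hlt
  refine final_core hC A h0 h0' hsub X hXA hXne hα hinv (by linarith : (2 : ℝ) ≤ 2 * (1 + C))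
    (by linarith) b1 ?_
  rw [Nat.card_eq_fintype_card, hcard]
  exact b2

end STP
end
end

section
/- Let q be a power of a prime and F_q the finite field with q elements. Let A ⊆ F_q be an additive subgroup with |A| ≥ 2, and write 1/A = {a^{-1} : a ∈ A, a ≠ 0}. Suppose there is a constant C > 0 such that for every proper subfield G of F_q and all elements c, d ∈ F_q one has |(1/A) ∩ (cG + d)| ≤ C·max{|G|^{1/2}, |A|^{4/7}}. Then there is a constant c' > 0 depending only on C such that both |1/A + 1/A| and |1/A − 1/A| are at least c'·(log|A|)^{-1/3}·min{|A|^{1 + 1/21}, q^{1/19}|A|^{1 - 1/19}}. -/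
open scoped Classical Pointwise

noncomputable section

namespace STP

variable {F : Type} [Field F]

lemma fiber_le {α β : Type*} (s : Finset α) (T : Finset β) (f : α → β) (m : ℝ)
    (hf : ∀ a ∈ s, f a ∈ T) (h : ∀ t ∈ T, ((s.filter fun a => f a = t).card : ℝ) ≤ m) :
    (s.card : ℝ) ≤ m * T.card := by
  rw [Finset.card_eq_sum_card_fiberwise (f := f) (t := T) (by intro a ha; exact hf a ha)]
  push_cast
  calc _ ≤ ∑ t ∈ T, m := Finset.sum_le_sum (fun t ht => h t ht)
    _ = _ := by simp [mul_comm]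

lemma fiber_exists {α β : Type*} (s : Finset α) (T : Finset β) (f : α → β) (m : ℝ)
    (hf : ∀ a ∈ s, f a ∈ T) (hT : T.Nonempty) (h : m * T.card ≤ s.card) :
    ∃ t ∈ T, m ≤ ((s.filter fun a => f a = t).card : ℝ) := by
  rw [Finset.card_eq_sum_card_fiberwise (f := f) (t := T) (by intro a ha; exact hf a ha)] at h
  push_cast at h
  apply Finset.exists_le_of_sum_le hT
  simpa [mul_comm] using h

lemma cs_fiber {α β : Type*} (s : Finset α) (T : Finset β) (f : α → β)
    (hf : ∀ a ∈ s, f a ∈ T) :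
    (s.card : ℝ) ^ 2 ≤ T.card * (((s ×ˢ s).filter fun p => f p.1 = f p.2).card : ℝ) := by
  have h1 : ((s ×ˢ s).filter fun p => f p.1 = f p.2).card
      = ∑ t ∈ T, ((s.filter fun a => f a = t).card) ^ 2 := by
    rw [Finset.card_eq_sum_card_fiberwise (f := fun p => f p.1) (t := T)
      (by intro p hp; simp at hp; exact hf _ hp.1.1)]
    apply Finset.sum_congr rfl
    intro t ht
    rw [sq, ← Finset.card_product]
    congr 1
    ext ⟨a, b⟩
    simp only [Finset.mem_filter, Finset.mem_product]
    constructor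
    · rintro ⟨⟨⟨ha, hb⟩, h⟩, h'⟩; exact ⟨⟨ha, h'⟩, hb, by rw [← h, h']⟩
    · rintro ⟨⟨ha, h'⟩, hb, h⟩; exact ⟨⟨⟨ha, hb⟩, by rw [h, h']⟩, h'⟩
  rw [h1, Finset.card_eq_sum_card_fiberwise (f := f) (t := T) (by intro a ha; exact hf a ha)]
  have := sq_sum_le_card_mul_sum_sq (s := T) (f := fun t => ((s.filter fun a => f a = t).card : ℝ))
  push_cast
  exact this

lemma few_rep (W G : Finset F) (hG : G.Nonempty) :
    ∃ r ∈ G, (W.card : ℝ) ^ 2 * G.card ≤ (W.card ^ 2 + G.card) * ((W + r • W).card : ℝ) := by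
  set s : Finset (F × (F × F) × (F × F)) := (G ×ˢ (W ×ˢ W) ×ˢ (W ×ˢ W)).filter
    fun p => p.2.1.1 + p.1 * p.2.1.2 = p.2.2.1 + p.1 * p.2.2.2 with hs
  have hfib : ∀ r ∈ G, (W.card : ℝ) ^ 4 ≤ ((W + r • W).card : ℝ) *
      ((s.filter fun p => p.1 = r).card : ℝ) := by
    intro r hr
    have h := cs_fiber (W ×ˢ W) (W + r • W) (fun p => p.1 + r * p.2) (by
      intro a ha
      simp only [Finset.mem_product] at ha
      exact Finset.add_mem_add ha.1 (Finset.smul_mem_smul_finset ha.2))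
    have e : (((W ×ˢ W) ×ˢ (W ×ˢ W)).filter fun p => p.1.1 + r * p.1.2 = p.2.1 + r * p.2.2).card
        = (s.filter fun p => p.1 = r).card := by
      apply Finset.card_bij (fun p _ => (r, p))
      · intro p hp
        simp only [hs, Finset.mem_filter, Finset.mem_product] at hp ⊢
        exact ⟨⟨⟨hr, hp.1⟩, hp.2⟩, trivial⟩
      · intro p _ p' _ h; exact (Prod.mk.inj h).2
      · rintro ⟨r', p⟩ hp
        simp only [hs, Finset.mem_filter, Finset.mem_product] at hp
        obtain ⟨⟨⟨h1, h2⟩, h3⟩, rfl⟩ := hp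
        exact ⟨p, by simp only [Finset.mem_filter, Finset.mem_product]; exact ⟨h2, h3⟩, rfl⟩
    rw [← e]
    calc (W.card : ℝ) ^ 4 = ((W ×ˢ W).card : ℝ) ^ 2 := by rw [Finset.card_product]; push_cast; ring
      _ ≤ _ := h
  have hs_card : (s.card : ℝ) ≤ G.card * W.card ^ 2 + W.card ^ 4 := by
    have h1 : (s.filter fun p => p.2.1 = p.2.2).card ≤ (G ×ˢ (W ×ˢ W)).card := by
      apply Finset.card_le_card_of_injOn (fun p => (p.1, p.2.1))
      · intro p hp
        simp only [hs, Finset.coe_filter, Set.mem_ofPred_eq, Finset.mem_filter, Finset.mem_product] at hp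
        simp only [Finset.coe_product, Set.mem_prod, Finset.mem_coe]
        exact ⟨hp.1.1.1, hp.1.1.2.1⟩
      · rintro ⟨r, p, p'⟩ hp ⟨r', u, u'⟩ hu h
        simp only [Finset.coe_filter, Set.mem_ofPred_eq] at hp hu
        simp only [Prod.mk.injEq] at h
        obtain ⟨_, h1⟩ := hp
        obtain ⟨_, h2⟩ := hu
        subst h1 h2
        rw [h.1, h.2]
    have h2 : (s.filter fun p => ¬ p.2.1 = p.2.2).card ≤ ((W ×ˢ W) ×ˢ (W ×ˢ W)).card := by
      apply Finset.card_le_card_of_injOn (fun p => p.2)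
      · intro p hp
        simp only [hs, Finset.coe_filter, Set.mem_ofPred_eq, Finset.mem_filter, Finset.mem_product] at hp
        simp only [Finset.coe_product, Set.mem_prod, Finset.mem_coe]
        exact hp.1.1.2
      · rintro ⟨r, ⟨a, b⟩, c, d⟩ hp ⟨r', u⟩ hu h
        simp only at h
        subst h
        simp only [hs, Finset.coe_filter, Set.mem_ofPred_eq, Finset.mem_filter, Prod.mk.injEq] at hp hu
        obtain ⟨⟨_, h1⟩, hne⟩ := hp
        obtain ⟨⟨_, h2⟩, _⟩ := hu
        have hbd : b ≠ d := by
          rintro rfl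
          exact hne ⟨by simpa using h1, rfl⟩
        have : (r - r') * (b - d) = 0 := by linear_combination h1 - h2
        rcases mul_eq_zero.1 this with h | h
        · rw [sub_eq_zero.1 h]
        · exact absurd (sub_eq_zero.1 h) hbd
    have h3 := Finset.card_filter_add_card_filter_not (s := s) (fun p => p.2.1 = p.2.2)
    have : s.card ≤ G.card * W.card ^ 2 + W.card ^ 4 := by
      rw [← h3]
      simp only [Finset.card_product] at h1 h2
      nlinarith
    exact_mod_cast this
  by_contra hcon
  push Not at hcon
  rcases Nat.eq_zero_or_pos W.card with h0 | hpos
  · obtain ⟨r, hr⟩ := hG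
    have := hcon r hr
    have h0' : (W.card : ℝ) = 0 := by exact_mod_cast h0
    rw [h0'] at this
    have : (0:ℝ) ≤ (0 ^ 2 + G.card) * ((W + r • W).card : ℝ) := by positivity
    linarith
  have hw : (0:ℝ) < W.card := by exact_mod_cast hpos
  have hg : (0:ℝ) < G.card := by exact_mod_cast hG.card_pos
  have hbig : ∀ r ∈ G, ((W.card : ℝ) ^ 2 * (W.card ^ 2 + G.card)) / G.card <
      ((s.filter fun p => p.1 = r).card : ℝ) := by
    intro r hr
    have h1 := hfib r hr
    have h2 := hcon r hr
    rw [div_lt_iff₀ hg]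
    have hS : (0:ℝ) ≤ ((s.filter fun p => p.1 = r).card : ℝ) := by positivity
    have hx : (0:ℝ) < W.card ^ 2 + G.card := by positivity
    by_contra hle
    push Not at hle
    have hM : (0:ℝ) ≤ ((W + r • W).card : ℝ) := by positivity
    have a1 : (W.card : ℝ) ^ 4 * G.card ≤ (W + r • W).card * ((W.card : ℝ) ^ 2 * (W.card ^ 2 + G.card)) := by
      calc _ ≤ ((W + r • W).card : ℝ) * ((s.filter fun p => p.1 = r).card : ℝ) * G.card := by gcongr
        _ = ((W + r • W).card : ℝ) * (((s.filter fun p => p.1 = r).card : ℝ) * G.card) := by ring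
        _ ≤ _ := by gcongr
    have a2 := mul_lt_mul_of_pos_left h2 (show (0:ℝ) < (W.card:ℝ)^2 by positivity)
    nlinarith
  have hsum : (s.card : ℝ) = ∑ r ∈ G, ((s.filter fun p => p.1 = r).card : ℝ) := by
    rw [Finset.card_eq_sum_card_fiberwise (f := fun p => p.1) (t := G)
      (by intro p hp; simp only [hs, Finset.coe_filter, Set.mem_ofPred_eq, Finset.mem_product] at hp; exact hp.1.1)]
    push_cast; rfl
  have := Finset.sum_lt_sum_of_nonempty hG hbig
  rw [← hsum, Finset.sum_const, nsmul_eq_mul, mul_div_cancel₀ _ hg.ne'] at this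
  nlinarith

lemma quot_field [Fintype F] (W : Finset F) (h0 : (0:F) ∉ W) (h2 : 2 ≤ W.card)
    (hadd : ∀ r ∈ quotSet W, 1 + r ∈ quotSet W)
    (hmul : ∀ w ∈ W, ∀ r ∈ quotSet W, w * r ∈ quotSet W) :
    ∃ G : Subfield F, (G : Set F) = quotSet W := by
  obtain ⟨u, hu, v, hv, huv⟩ := Finset.one_lt_card.1 h2
  have hz : (0:F) ∈ quotSet W := ⟨u, hu, u, hu, u, hu, v, hv, huv, by simp⟩
  have hinv : ∀ r ∈ quotSet W, r⁻¹ ∈ quotSet W := by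
    intro r hr
    by_cases hr0 : r = 0
    · subst hr0; simpa using hz
    obtain ⟨a, ha, b, hb, c, hc, d, hd, hcd, rfl⟩ := hr
    refine ⟨c, hc, d, hd, a, ha, b, hb, ?_, by rw [inv_div]⟩
    rintro rfl
    simp at hr0
  let M : Submonoid F := 
    { carrier := {m | m ≠ 0 ∧ ∀ r ∈ quotSet W, m * r ∈ quotSet W}
      one_mem' := ⟨one_ne_zero, fun r hr => by simpa using hr⟩
      mul_mem' := by
        rintro a b ⟨ha, ha'⟩ ⟨hb, hb'⟩
        exact ⟨mul_ne_zero ha hb, fun r hr => by rw [mul_assoc]; exact ha' _ (hb' _ hr)⟩ }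
  have hWM : Submonoid.closure (W : Set F) ≤ M := by
    rw [Submonoid.closure_le]
    intro w hw
    exact ⟨fun h => h0 (h ▸ hw), fun r hr => hmul w hw r hr⟩
  have hM : ∀ m ∈ M, ∀ r ∈ quotSet W, r + m ∈ quotSet W := by
    rintro m ⟨hm0, hm⟩ r hr
    have h1 : m⁻¹ * r ∈ quotSet W := by
      have := hinv _ (hm _ (hinv r hr))
      simpa [mul_inv, mul_comm] using this
    have := hm _ (hadd _ h1)
    convert this using 1
    field_simp
    ring
  have hR : ∀ x ∈ Subring.closure (W : Set F), ∀ r ∈ quotSet W, r + x ∈ quotSet W := by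
    intro x hx
    rw [Subring.mem_closure_iff] at hx
    induction hx using AddSubgroup.closure_induction with
    | mem x hx => exact hM x (hWM hx)
    | zero => intro r hr; simpa using hr
    | add x y _ _ hx hy => intro r hr; rw [← add_assoc]; exact hy _ (hx _ hr)
    | neg x _ hx =>
      intro r hr
      have key : ∀ n : ℕ, r + n • x ∈ quotSet W := by
        intro n
        induction n with
        | zero => simpa using hr
        | succ n ih => rw [succ_nsmul, ← add_assoc]; exact hx _ ih
      have e : -x = (Fintype.card F - 1) • x := by
        rw [neg_eq_iff_add_eq_zero, ← succ_nsmul', Nat.sub_add_cancel Fintype.card_pos]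
        exact card_nsmul_eq_zero
      rw [e]; exact key _
  let G : Subfield F := 
    { Subring.closure (W : Set F) with
      inv_mem' := by
        intro x hx
        by_cases hx0 : x = 0
        · subst hx0; simp
        have h1 : 1 < Fintype.card F := Fintype.one_lt_card
        have : x⁻¹ = x ^ (Fintype.card F - 2) := by
          apply inv_eq_of_mul_eq_one_right
          rw [← pow_succ']
          rw [show Fintype.card F - 2 + 1 = Fintype.card F - 1 by omega]
          exact FiniteField.pow_card_sub_one_eq_one x hx0
        rw [this]
        exact (Subring.closure (W : Set F)).pow_mem hx _ }
  refine ⟨G, Set.Subset.antisymm ?_ ?_⟩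
  · intro x hx
    have := hR x hx 0 hz
    simpa using this
  · rintro _ ⟨a, ha, b, hb, c, hc, d, hd, hcd, rfl⟩
    have hm : ∀ w ∈ W, w ∈ G := fun w hw => Subring.subset_closure hw
    exact G.div_mem (G.sub_mem (hm a ha) (hm b hb)) (G.sub_mem (hm c hc) (hm d hd))

lemma core_s12 (B : Finset F) (k : ℝ) (hk : 1 ≤ k) (h0 : (0:F) ∉ B)
    (hneg : ∀ b ∈ B, -b ∈ B)
    (hB : ∀ b ∈ B, ∀ c ∈ B, b ≠ c → b * c / (b - c) ∈ B)
    (hn : 4 ≤ B.card) (hkB : ((B - B).card : ℝ) = k * B.card) :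
    ∃ (W : Finset F) (s f : F), s ≠ 0 ∧ (0:F) ∉ W ∧ (B.card : ℝ) / (128 * k ^ 2) ≤ W.card ∧
      (∀ w ∈ W, f + s * w ∈ B) ∧
      (∀ w ∈ W, ∃ e : F, (B.card : ℝ) / (32 * k) ≤ (((w • B) ∩ ({e} + B)).card : ℝ)) := by
  have hk0 : 0 < k := by linarith
  set n : ℝ := (B.card : ℝ) with hndef
  have hn4 : (4:ℝ) ≤ n := by rw [hndef]; exact_mod_cast hn
  have hne : ∀ b ∈ B, b ≠ 0 := fun b hb h => h0 (h ▸ hb)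
  let ρ : F → Finset (F × F) := fun d => (B ×ˢ B).filter fun p => p.1 - p.2 = d
  let τ : F × F → F := fun p => (p.1 - p.2) / p.1 ^ 2
  let T : Finset F := (B - B).image fun x => x⁻¹
  let Tb : F → Finset F := fun b => B.image fun c => τ (b, c)
  have hTcard : (T.card : ℝ) ≤ k * n := by
    rw [← hkB]; exact_mod_cast Finset.card_image_le
  let Ω : Finset (F × F) := (B ×ˢ B).filter fun p => p.1 ≠ p.2 ∧ n / (2 * k) ≤ ((ρ (p.1 - p.2)).card : ℝ)
  have hΩT : ∀ p ∈ Ω, τ p ∈ T := by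
    rintro ⟨b, c⟩ hp
    simp only [Ω, Finset.mem_filter, Finset.mem_product] at hp
    obtain ⟨⟨hb, hc⟩, hbc, -⟩ := hp
    refine Finset.mem_image.2 ⟨b - -(b * c / (b - c)), Finset.sub_mem_sub hb (hneg _ (hB b hb c hc hbc)), ?_⟩
    have h1 := hne b hb
    have h2 : b - c ≠ 0 := sub_ne_zero.2 hbc
    have : b - -(b * c / (b - c)) = b ^ 2 / (b - c) := by field_simp; ring
    simp only [τ]
    rw [this, inv_div]
  have hBB : ((B ×ˢ B).card : ℝ) = n ^ 2 := by rw [Finset.card_product]; push_cast; ring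
  have hΩle : (Ω.card : ℝ) ≤ n ^ 2 := by
    rw [← hBB]; exact_mod_cast Finset.card_filter_le _ _
  have hΩ : n ^ 2 / 4 ≤ (Ω.card : ℝ) := by
    have hsub : (B ×ˢ B) ⊆ Ω ∪ ((B ×ˢ B).filter (fun p => p.1 = p.2) ∪
        (B ×ˢ B).filter (fun p => ((ρ (p.1 - p.2)).card : ℝ) ≤ n / (2 * k))) := by
      intro p hp
      simp only [Ω, Finset.mem_union, Finset.mem_filter]
      by_cases h1 : p.1 = p.2
      · right; left; exact ⟨hp, h1⟩
      · rcases le_total (n / (2 * k)) ((ρ (p.1 - p.2)).card : ℝ) with h | h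
        · left; exact ⟨hp, h1, h⟩
        · right; right; exact ⟨hp, h⟩
    have c1 : ((B ×ˢ B).filter (fun p => p.1 = p.2)).card ≤ B.card := by
      apply Finset.card_le_card_of_injOn (fun p => p.1)
      · intro p hp
        simp only [Finset.coe_filter, Set.mem_ofPred_eq, Finset.mem_product] at hp
        exact hp.1.1
      · rintro ⟨a, b⟩ hp ⟨c, d⟩ hq h
        simp only [Finset.coe_filter, Set.mem_ofPred_eq, Finset.mem_product] at hp hq h
        simp only [Prod.mk.injEq]
        exact ⟨h, by rw [← hp.2, ← hq.2, h]⟩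
    have c2 : (((B ×ˢ B).filter (fun p => ((ρ (p.1 - p.2)).card : ℝ) ≤ n / (2 * k))).card : ℝ)
        ≤ n / (2 * k) * (B - B).card := by
      apply fiber_le _ (B - B) (fun p => p.1 - p.2)
      · intro p hp
        simp only [Finset.mem_filter, Finset.mem_product] at hp
        exact Finset.sub_mem_sub hp.1.1 hp.1.2
      · intro t ht
        by_cases hh : ((ρ t).card : ℝ) ≤ n / (2 * k)
        · refine le_trans ?_ hh
          exact_mod_cast Finset.card_le_card (by
            intro p hp
            simp only [Finset.mem_filter, ρ] at hp ⊢
            exact ⟨hp.1.1, hp.2⟩)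
        · have : (((B ×ˢ B).filter (fun p => ((ρ (p.1 - p.2)).card : ℝ) ≤ n / (2 * k))).filter
              fun p => p.1 - p.2 = t) = ∅ := by
            apply Finset.filter_eq_empty_iff.2
            intro p hp h
            simp only [Finset.mem_filter] at hp
            rw [h] at hp
            exact hh hp.2
          rw [this]; simp; positivity
    rw [hkB] at c2
    have e2 : n / (2 * k) * (k * n) = n ^ 2 / 2 := by field_simp
    rw [e2] at c2
    have h1 := Finset.card_le_card hsub
    have h2 := h1.trans ((Finset.card_union_le _ _).trans (add_le_add le_rfl (Finset.card_union_le _ _)))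
    have h3 : ((B ×ˢ B).card : ℝ) ≤ Ω.card + (((B ×ˢ B).filter (fun p => p.1 = p.2)).card +
        ((B ×ˢ B).filter (fun p => ((ρ (p.1 - p.2)).card : ℝ) ≤ n / (2 * k))).card) := by
      exact_mod_cast h2
    have c1' : (((B ×ˢ B).filter (fun p => p.1 = p.2)).card : ℝ) ≤ n := by
      rw [hndef]; exact_mod_cast c1
    rw [hBB] at h3
    nlinarith
  let Q := (Ω ×ˢ Ω).filter fun p => τ p.1 = τ p.2
  have hQ : n ^ 3 / (16 * k) ≤ (Q.card : ℝ) := by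
    have h := cs_fiber Ω T τ hΩT
    have h1 : (n ^ 2 / 4) ^ 2 ≤ k * n * (Q.card : ℝ) := by
      calc (n ^ 2 / 4) ^ 2 ≤ (Ω.card : ℝ) ^ 2 := by gcongr
        _ ≤ _ := h
        _ ≤ _ := by gcongr
    rw [div_le_iff₀ (by positivity)]
    have : n * n ^ 3 ≤ n * (Q.card * (16 * k)) := by nlinarith
    exact le_of_mul_le_mul_left this (by linarith)
  let good : F → F → Prop := fun b b' => n / (32 * k) ≤ ((Tb b ∩ Tb b').card : ℝ)
  have hinjτ : ∀ b ∈ B, ∀ c c' : F, τ (b, c) = τ (b, c') → c = c' := by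
    intro b hb c c' h
    have := hne b hb
    simp only [τ] at h
    have h2 : b ^ 2 ≠ 0 := pow_ne_zero _ this
    rw [div_left_inj' h2] at h
    exact sub_right_injective h
  have hQbad : ((Q.filter fun p => ¬ good p.1.1 p.2.1).card : ℝ) ≤ n / (32 * k) * n ^ 2 := by
    rw [← hBB]
    apply fiber_le _ (B ×ˢ B) (fun p => (p.1.1, p.2.1))
    · rintro ⟨p, p'⟩ hp
      simp only [Q, Ω, Finset.mem_filter, Finset.mem_product] at hp ⊢
      exact ⟨hp.1.1.1.1.1, hp.1.1.2.1.1⟩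
    · rintro ⟨b, b'⟩ hbb
      simp only [Finset.mem_product] at hbb
      by_cases hg : good b b'
      · refine le_trans (le_of_eq ?_) (show (0:ℝ) ≤ n / (32 * k) by positivity)
        rw [Nat.cast_eq_zero, Finset.card_eq_zero]
        apply Finset.eq_empty_of_forall_notMem
        intro p hp
        simp only [Finset.mem_filter, Prod.mk.injEq] at hp
        obtain ⟨⟨_, hb1⟩, h1, h2⟩ := hp
        rw [h1, h2] at hb1
        exact hb1 hg
      · have hg' := hg
        simp only [good, not_le] at hg'
        refine le_trans ?_ hg'.le
        norm_cast
        apply Finset.card_le_card_of_injOn (fun p => τ p.1)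
        · rintro ⟨⟨p1, p2⟩, p'1, p'2⟩ hp
          simp only [Q, Ω, Finset.coe_filter, Set.mem_ofPred_eq, Finset.mem_filter, Finset.mem_product, Prod.mk.injEq] at hp
          obtain ⟨⟨⟨⟨⟨⟨h1, h2⟩, -⟩, ⟨h3, h4⟩, -⟩, h5⟩, -⟩, rfl, rfl⟩ := hp
          simp only [Finset.coe_inter, Set.mem_inter_iff, Finset.mem_coe, Tb, Finset.mem_image]
          exact ⟨⟨p2, h2, rfl⟩, p'2, h4, h5.symm⟩
        · rintro ⟨⟨p1, p2⟩, p'1, p'2⟩ hp ⟨⟨q1, q2⟩, q'1, q'2⟩ hq h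
          simp only [Q, Ω, Finset.coe_filter, Set.mem_ofPred_eq, Finset.mem_filter, Finset.mem_product, Prod.mk.injEq] at hp hq h
          obtain ⟨⟨⟨-, h5⟩, -⟩, rfl, rfl⟩ := hp
          obtain ⟨⟨⟨-, h6⟩, -⟩, rfl, rfl⟩ := hq
          have e1 := hinjτ _ hbb.1 _ _ h
          have e2 := hinjτ _ hbb.2 _ _ (h5.symm.trans (h.trans h6))
          rw [e1, e2]
  have hQgood : n / (32 * k) * Ω.card ≤ ((Q.filter fun p => good p.1.1 p.2.1).card : ℝ) := by
    have h3 := Finset.card_filter_add_card_filter_not (s := Q) (fun p => good p.1.1 p.2.1)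
    have h3' : ((Q.filter fun p => good p.1.1 p.2.1).card : ℝ) +
      ((Q.filter fun p => ¬ good p.1.1 p.2.1).card : ℝ) = Q.card := by exact_mod_cast h3
    have e : n ^ 3 / (16 * k) = n / (32 * k) * n ^ 2 + n / (32 * k) * n ^ 2 := by field_simp; ring
    have : n / (32 * k) * Ω.card ≤ n / (32 * k) * n ^ 2 := by gcongr
    linarith
  have hΩne : Ω.Nonempty := by
    rw [← Finset.card_pos]
    have : (0:ℝ) < Ω.card := by nlinarith
    exact_mod_cast this
  obtain ⟨⟨bs, cs⟩, hps, hfib⟩ := fiber_exists (Q.filter fun p => good p.1.1 p.2.1) Ω (fun p => p.2)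
    (n / (32 * k)) (by
      intro p hp
      simp only [Q, Finset.mem_filter, Finset.mem_product] at hp
      exact hp.1.1.2) hΩne hQgood
  set t : F := τ (bs, cs) with ht
  have hps' := hps
  simp only [Ω, Finset.mem_filter, Finset.mem_product] at hps'
  obtain ⟨⟨hbs, hcs⟩, hbcs, -⟩ := hps'
  have hbs0 := hne bs hbs
  have ht0 : t ≠ 0 := by
    simp only [ht, τ]
    exact div_ne_zero (sub_ne_zero.2 hbcs) (pow_ne_zero _ hbs0)
  let X : Finset F := B.filter fun b => good b bs ∧ n / (2 * k) ≤ ((ρ (t * b ^ 2)).card : ℝ)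
  have hX : n / (32 * k) ≤ (X.card : ℝ) := by
    refine hfib.trans ?_
    norm_cast
    apply Finset.card_le_card_of_injOn (fun p => p.1.1)
    · rintro ⟨⟨b, c⟩, p'⟩ hp
      simp only [Q, Ω, Finset.coe_filter, Set.mem_ofPred_eq, Finset.mem_filter, Finset.mem_product] at hp
      obtain ⟨⟨⟨⟨⟨⟨hb, hc⟩, -, h1⟩, -⟩, h2⟩, h3⟩, rfl⟩ := hp
      simp only [X, Finset.coe_filter, Set.mem_ofPred_eq]
      refine ⟨hb, h3, ?_⟩
      have : t * b ^ 2 = b - c := by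
        rw [ht, ← h2]
        have := hne b hb
        simp only [τ]; field_simp
      rw [this]; exact h1
    · rintro ⟨⟨b, c⟩, p'⟩ hp ⟨⟨b', c'⟩, q'⟩ hq h
      simp only [Q, Ω, Finset.coe_filter, Set.mem_ofPred_eq, Finset.mem_filter, Finset.mem_product] at hp hq h
      obtain ⟨⟨⟨⟨⟨⟨hb, hc⟩, -⟩, -⟩, h2⟩, h3⟩, rfl⟩ := hp
      obtain ⟨⟨⟨-, h2'⟩, -⟩, rfl⟩ := hq
      subst h
      rw [hinjτ b hb c c' (h2.trans h2'.symm)]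
  let S := (X ×ˢ B).filter fun p => p.2 + t * p.1 ^ 2 ∈ B
  have hS : n / (2 * k) * X.card ≤ (S.card : ℝ) := by
    rw [Finset.card_eq_sum_card_fiberwise (s := S) (f := fun p => p.1) (t := X) (by
      intro p hp
      simp only [S, Finset.coe_filter, Set.mem_ofPred_eq, Finset.mem_product] at hp
      exact hp.1.1)]
    push_cast
    rw [mul_comm, ← nsmul_eq_mul]
    apply Finset.card_nsmul_le_sum
    intro b hb
    have hb' := hb
    simp only [X, Finset.mem_filter] at hb'
    refine hb'.2.2.trans ?_
    norm_cast
    apply Finset.card_le_card_of_injOn (fun p => (b, p.2))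
    · rintro ⟨e, g⟩ hp
      simp only [ρ, Finset.coe_filter, Set.mem_ofPred_eq, Finset.mem_product] at hp
      simp only [S, Finset.coe_filter, Set.mem_ofPred_eq, Finset.mem_filter, Finset.mem_product]
      refine ⟨⟨⟨hb, hp.1.2⟩, ?_⟩, trivial⟩
      rw [← hp.2]; simpa using hp.1.1
    · rintro ⟨e, g⟩ hp ⟨e', g'⟩ hq h
      simp only [ρ, Finset.coe_filter, Set.mem_ofPred_eq, Finset.mem_product, Prod.mk.injEq] at hp hq h
      obtain ⟨-, rfl⟩ := h
      have : e = e' := by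
        have := hp.2.trans hq.2.symm
        exact sub_left_injective this
      rw [this]
  have hBne : B.Nonempty := ⟨bs, hbs⟩
  obtain ⟨f, hf, hff⟩ := fiber_exists S B (fun p => p.2) (X.card / (2 * k)) (by
      intro p hp
      simp only [S, Finset.mem_filter, Finset.mem_product] at hp
      exact hp.1.2) hBne (by
      refine le_trans (le_of_eq ?_) hS
      rw [← hndef]; ring)
  let W : Finset F := (S.filter fun p => p.2 = f).image fun p => (p.1 / bs) ^ 2
  have hWmem : ∀ w ∈ W, ∃ b ∈ X, f + t * b ^ 2 ∈ B ∧ w = (b / bs) ^ 2 := by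
    intro w hw
    obtain ⟨⟨b, g⟩, hp, rfl⟩ := Finset.mem_image.1 hw
    simp only [S, Finset.mem_filter, Finset.mem_product] at hp
    obtain ⟨⟨⟨h1, h2⟩, h3⟩, rfl⟩ := hp
    exact ⟨b, h1, h3, rfl⟩
  have hXB : ∀ b ∈ X, b ∈ B := fun b hb => (Finset.mem_filter.1 hb).1
  refine ⟨W, t * bs ^ 2, f, mul_ne_zero ht0 (pow_ne_zero _ hbs0), ?_, ?_, ?_, ?_⟩
  · intro h
    obtain ⟨b, hb, -, h⟩ := hWmem 0 h
    exact pow_ne_zero 2 (div_ne_zero (hne b (hXB b hb)) hbs0) h.symm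
  · have h1 : ((S.filter fun p => p.2 = f).card : ℝ) ≤ 2 * W.card := by
      apply fiber_le _ W (fun p => (p.1 / bs) ^ 2)
      · intro p hp; exact Finset.mem_image_of_mem _ hp
      · intro w hw
        obtain ⟨b, hb, -, rfl⟩ := hWmem w hw
        have : ((S.filter fun p => p.2 = f).filter fun p => (p.1 / bs) ^ 2 = (b / bs) ^ 2) ⊆
            {(b, f), (-b, f)} := by
          rintro ⟨b', g⟩ hp
          simp only [Finset.mem_filter] at hp
          obtain ⟨⟨-, rfl⟩, h⟩ := hp
          rcases sq_eq_sq_iff_eq_or_eq_neg.1 h with h | h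
          · rw [div_left_inj' hbs0] at h
            simp [h]
          · rw [← neg_div, div_left_inj' hbs0] at h
            simp [h]
        exact_mod_cast (Finset.card_le_card this).trans Finset.card_le_two
    have h2 : n / (32 * k) / (2 * k) ≤ X.card / (2 * k) := by gcongr
    have h3 : n / (128 * k ^ 2) = n / (32 * k) / (2 * k) / 2 := by field_simp; ring
    rw [h3]
    linarith
  · intro w hw
    obtain ⟨b, hb, h, rfl⟩ := hWmem w hw
    convert h using 2
    field_simp
  · intro w hw
    obtain ⟨b, hb, h, rfl⟩ := hWmem w hw
    have hb' := Finset.mem_filter.1 hb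
    have hb0 := hne b hb'.1
    refine ⟨(b / bs) ^ 2 * bs - b, hb'.2.1.trans ?_⟩
    norm_cast
    apply Finset.card_le_card_of_injOn (fun t => (b / bs) ^ 2 * bs - b ^ 2 * t)
    · intro u hu
      simp only [Finset.coe_inter, Set.mem_inter_iff, Finset.mem_coe, Tb, Finset.mem_image] at hu
      obtain ⟨⟨c, hc, h1⟩, c', hc', h2⟩ := hu
      simp only [τ] at h1 h2
      simp only [Finset.coe_inter, Set.mem_inter_iff, Finset.mem_coe]
      constructor
      · refine Finset.mem_smul_finset.2 ⟨c', hc', ?_⟩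
        rw [← h2, smul_eq_mul]; field_simp; ring
      · refine Finset.mem_add.2 ⟨_, Finset.mem_singleton_self _, c, hc, ?_⟩
        rw [← h1]; field_simp; ring
    · intro u _ v _ h
      have h := sub_right_injective h
      exact mul_left_cancel₀ (pow_ne_zero 2 hb0) h

lemma smul_sub_subset (B : Finset F) (hneg : ∀ b ∈ B, -b ∈ B) (u v : F) :
    (u - v) • B ⊆ u • B + v • B := by
  intro x hx
  obtain ⟨b, hb, rfl⟩ := Finset.mem_smul_finset.1 hx
  refine Finset.mem_add.2 ⟨u • b, Finset.smul_mem_smul_finset hb, v • (-b),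
    Finset.smul_mem_smul_finset (hneg b hb), ?_⟩
  simp only [smul_eq_mul]; ring

lemma card_smul' (B : Finset F) (u : F) (hu : u ≠ 0) : (u • B).card = B.card := by
  apply Finset.card_image_of_injective
  intro x y h
  exact mul_left_cancel₀ hu h

lemma tri (X Y Z : Finset F) : ((X + Z).card : ℝ) * Y.card ≤ (X + Y).card * (Y + Z).card := by
  exact_mod_cast Finset.ruzsa_triangle_inequality_add_add_add X Y Z

lemma pl (B : Finset F) (hB : B.Nonempty) (k : ℝ) (h : ((B + B).card : ℝ) = k * B.card) :
    ((B + B + B).card : ℝ) ≤ k ^ 3 * B.card ∧ ((B + B + B + B).card : ℝ) ≤ k ^ 4 * B.card := by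
  have h0 : (0:ℝ) < B.card := by exact_mod_cast hB.card_pos
  have hk : ((B + B).card : ℝ) / B.card = k := by rw [h]; field_simp
  have h3 := Finset.pluennecke_ruzsa_inequality_nsmul_add hB B 3
  have h4 := Finset.pluennecke_ruzsa_inequality_nsmul_add hB B 4
  simp only [succ_nsmul, zero_nsmul, zero_add] at h3 h4
  rw [← hk]
  constructor
  · have := (NNRat.cast_le (K := ℝ)).2 h3
    push_cast at this
    exact this
  · have := (NNRat.cast_le (K := ℝ)).2 h4
    push_cast at this
    exact this

lemma upper (B W : Finset F) (k : ℝ) (hk : 1 ≤ k) (hBne : B.Nonempty)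
    (hneg : ∀ b ∈ B, -b ∈ B) (hkB : ((B + B).card : ℝ) = k * B.card) (h0 : (0:F) ∉ W)
    (hW : ∀ w ∈ W, ∃ e : F, (B.card : ℝ) / (32 * k) ≤ (((w • B) ∩ ({e} + B)).card : ℝ)) :
    (∀ r ∈ quotSet W, ((B + r • B).card : ℝ) ≤ 32 ^ 5 * k ^ 15 * B.card) ∧
    (∀ r ∈ quotSet W, ((B + (1 + r) • B).card : ℝ) ≤ 32 ^ 5 * k ^ 15 * B.card) ∧
    (∀ w ∈ W, ∀ r ∈ quotSet W, ((B + (w * r) • B).card : ℝ) ≤ 32 ^ 5 * k ^ 15 * B.card) := by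
  have hn : (0:ℝ) < B.card := by exact_mod_cast hBne.card_pos
  have hk0 : 0 < k := by linarith
  obtain ⟨h3B, h4B⟩ := pl B hBne k hkB
  have hZ : ∀ w ∈ W, ∀ Z : Finset F, ((Z + w • B).card : ℝ) ≤ 32 * k ^ 2 * (Z + B).card := by
    intro w hw Z
    obtain ⟨e, he⟩ := hW w hw
    set I := (w • B) ∩ ({e} + B) with hI
    have hw0 : w ≠ 0 := fun h => h0 (h ▸ hw)
    have h1 := tri Z I (w • B)
    have h2 : ((Z + I).card : ℝ) ≤ (Z + B).card := by
      have : (Z + I).card ≤ (Z + ({e} + B)).card :=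
        Finset.card_le_card (Finset.add_subset_add_left Finset.inter_subset_right)
      rw [add_left_comm, Finset.card_singleton_add] at this
      exact_mod_cast this
    have h3 : ((I + w • B).card : ℝ) ≤ k * B.card := by
      have : (I + w • B).card ≤ (w • B + w • B).card :=
        Finset.card_le_card (Finset.add_subset_add_right Finset.inter_subset_left)
      rw [← smul_add, card_smul' _ _ hw0] at this
      rw [← hkB]; exact_mod_cast this
    have h4 : ((Z + w • B).card : ℝ) * (B.card / (32 * k)) ≤ (Z + B).card * (k * B.card) := by
      calc _ ≤ ((Z + w • B).card : ℝ) * I.card := by gcongr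
        _ ≤ _ := h1
        _ ≤ _ := by gcongr
    have h5 : ((Z + w • B).card : ℝ) * (B.card / (32 * k)) ≤
        (32 * k ^ 2 * (Z + B).card) * (B.card / (32 * k)) := by
      refine h4.trans (le_of_eq ?_)
      field_simp
    exact le_of_mul_le_mul_right h5 (by positivity)
  have hR : ∀ r ∈ quotSet W, ((B + r • B).card : ℝ) ≤ 32 ^ 4 * k ^ 12 * B.card := by
    rintro r ⟨a, ha, b, hb, c, hc, d, hd, hcd, rfl⟩
    have hcd' : c - d ≠ 0 := sub_ne_zero.2 hcd
    have e1 : (B + ((a - b) / (c - d)) • B).card ≤ (c • B + d • B + a • B + b • B).card := by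
      rw [← card_smul' _ (c - d) hcd', smul_add, smul_smul, mul_div_cancel₀ _ hcd']
      apply Finset.card_le_card
      rw [add_assoc (c • B + d • B)]
      exact Finset.add_subset_add (smul_sub_subset B hneg c d) (smul_sub_subset B hneg a b)
    have e1' : ((B + ((a - b) / (c - d)) • B).card : ℝ) ≤ ((c • B + d • B + a • B + b • B).card : ℝ) := by
      exact_mod_cast e1
    have s1 := hZ b hb (c • B + d • B + a • B)
    have s2 := hZ a ha (c • B + d • B + B)
    have s3 := hZ d hd (c • B + B + B)
    have s4 := hZ c hc (B + B + B)
    rw [show c • B + d • B + B + a • B = c • B + d • B + a • B + B by abel] at s2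
    rw [show c • B + B + B + d • B = c • B + d • B + B + B by abel] at s3
    rw [show B + B + B + c • B = c • B + B + B + B by abel] at s4
    calc _ ≤ _ := e1'
      _ ≤ _ := s1
      _ ≤ 32 * k ^ 2 * (32 * k ^ 2 * (c • B + d • B + B + B).card) := by gcongr
      _ ≤ 32 * k ^ 2 * (32 * k ^ 2 * (32 * k ^ 2 * (c • B + B + B + B).card)) := by gcongr
      _ ≤ 32 * k ^ 2 * (32 * k ^ 2 * (32 * k ^ 2 * (32 * k ^ 2 * (B + B + B + B).card))) := by gcongr
      _ ≤ 32 * k ^ 2 * (32 * k ^ 2 * (32 * k ^ 2 * (32 * k ^ 2 * (k ^ 4 * B.card)))) := by gcongr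
      _ = _ := by ring
  have hk3 : 1 ≤ k ^ 3 := one_le_pow₀ hk
  refine ⟨?_, ?_, ?_⟩
  · intro r hr
    refine (hR r hr).trans ?_
    have : (0:ℝ) < k ^ 12 * B.card := by positivity
    calc (32:ℝ) ^ 4 * k ^ 12 * B.card ≤ 32 ^ 5 * k ^ 12 * B.card * 1 := by nlinarith
      _ ≤ 32 ^ 5 * k ^ 12 * B.card * k ^ 3 := by gcongr
      _ = _ := by ring
  · intro r hr
    have h1 := hR r hr
    have h2 : ((B + (1 + r) • B).card : ℝ) ≤ (B + B + r • B).card := by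
      norm_cast
      apply Finset.card_le_card
      rw [add_assoc]
      apply Finset.add_subset_add_left
      intro x hx
      obtain ⟨b, hb, rfl⟩ := Finset.mem_smul_finset.1 hx
      refine Finset.mem_add.2 ⟨b, hb, r • b, Finset.smul_mem_smul_finset hb, ?_⟩
      simp only [smul_eq_mul]; ring
    have h3 := tri (B + B) B (r • B)
    have h4 : ((B + (1 + r) • B).card : ℝ) * B.card ≤ (32 ^ 5 * k ^ 15 * B.card) * B.card := by
      calc _ ≤ ((B + B + r • B).card : ℝ) * B.card := by gcongr
        _ ≤ _ := h3
        _ ≤ (k ^ 3 * B.card) * (32 ^ 4 * k ^ 12 * B.card) := by gcongr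
        _ = 32 ^ 4 * (k ^ 15 * B.card * B.card) := by ring
        _ ≤ 32 ^ 5 * (k ^ 15 * B.card * B.card) := by gcongr <;> norm_num
        _ = _ := by ring
    exact le_of_mul_le_mul_right h4 hn
  · intro w hw r hr
    have hw0 : w ≠ 0 := fun h => h0 (h ▸ hw)
    have h1 := hR r hr
    have h2 := hZ w hw B
    have h3 := tri B (w • B) ((w * r) • B)
    rw [mul_smul, ← smul_add, card_smul' _ w hw0, card_smul' _ w hw0] at h3
    have h4 : ((B + (w * r) • B).card : ℝ) * B.card ≤ (32 ^ 5 * k ^ 15 * B.card) * B.card := by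
      rw [mul_smul]
      calc ((B + w • r • B).card : ℝ) * B.card ≤ (B + w • B).card * (B + r • B).card := h3
        _ ≤ (32 * k ^ 2 * (B + B).card) * (32 ^ 4 * k ^ 12 * B.card) := by gcongr
        _ = _ := by rw [hkB]; ring
    exact le_of_mul_le_mul_right h4 hn

lemma affine_le (B W : Finset F) (s f r : F) (hs : s ≠ 0) (h : ∀ w ∈ W, f + s * w ∈ B) :
    ((W + r • W).card : ℝ) ≤ (B + r • B).card := by
  norm_cast
  apply Finset.card_le_card_of_injOn (fun x => f + r * f + s * x)
  · intro x hx
    obtain ⟨a, ha, c, hc, rfl⟩ := Finset.mem_add.1 hx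
    obtain ⟨b, hb, rfl⟩ := Finset.mem_smul_finset.1 hc
    refine Finset.mem_coe.2 (Finset.mem_add.2 ⟨_, h a ha, _, Finset.smul_mem_smul_finset (h b hb), ?_⟩)
    simp only [smul_eq_mul]; ring
  · intro x _ y _ hxy
    exact mul_left_cancel₀ hs (add_left_cancel hxy)

lemma not_quot (W : Finset F) (x : F) (hx : x ∉ quotSet W) :
    (W.card : ℝ) ^ 2 ≤ (W + x • W).card := by
  rw [sq]
  norm_cast
  rw [← Finset.card_product]
  apply Finset.card_le_card_of_injOn (fun p => p.1 + x * p.2)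
  · rintro ⟨a, b⟩ h
    simp only [Finset.coe_product, Set.mem_prod, Finset.mem_coe] at h
    exact Finset.add_mem_add h.1 (Finset.smul_mem_smul_finset h.2)
  · rintro ⟨a, b⟩ h ⟨c, d⟩ h' hh
    simp only [Finset.coe_product, Set.mem_prod, Finset.mem_coe] at h h' hh
    by_cases hbd : b = d
    · subst hbd
      rw [add_right_cancel hh]
    · exfalso
      apply hx
      refine ⟨c, h'.1, a, h.1, b, h.2, d, h'.2, hbd, ?_⟩
      rw [eq_div_iff (sub_ne_zero.2 hbd)]
      linear_combination hh

set_option maxHeartbeats 2000000 in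
lemma main [Fintype F] (B : Finset F) (C N k : ℝ) (hC : 0 < C) (hk : 1 ≤ k) (h0 : (0:F) ∉ B)
    (hneg : ∀ b ∈ B, -b ∈ B)
    (hB : ∀ b ∈ B, ∀ c ∈ B, b ≠ c → b * c / (b - c) ∈ B)
    (hBne : B.Nonempty) (hkB : ((B - B).card : ℝ) = k * B.card)
    (hkB' : ((B + B).card : ℝ) = k * B.card)
    (hN : N = B.card + 1) (hsub : subfieldCond B C (N ^ ((4:ℝ)/7))) :
    N ≤ (2 * (C ^ 2 + 2) * 128 ^ 2 * 32 ^ 5 + (256 * C) ^ 7) * k ^ 21 ∨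
    (Fintype.card F : ℝ) ≤ (2 * (C ^ 2 + 2) * 128 ^ 2 * 32 ^ 5 + (256 * C) ^ 7) * k ^ 19 * N := by
  have hn : (1:ℝ) ≤ B.card := by exact_mod_cast hBne.card_pos
  have hk0 : 0 < k := by linarith
  have hN2 : N ≤ 2 * B.card := by linarith
  have hN1 : 1 ≤ N := by linarith
  set n : ℝ := (B.card : ℝ) with hndef
  have hCp : (0:ℝ) < (256 * C) ^ 7 := by positivity
  have hC2 : (0:ℝ) < C ^ 2 := by positivity
  set D : ℝ := 2 * (C ^ 2 + 2) * 128 ^ 2 * 32 ^ 5 + (256 * C) ^ 7 with hD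
  have hD1 : 2 * (C ^ 2 + 2) * 128 ^ 2 * 32 ^ 5 ≤ D := by linarith
  have hD2 : (256 * C) ^ 7 ≤ D := by
    have : 0 < 2 * (C ^ 2 + 2) * 128 ^ 2 * 32 ^ 5 := by positivity
    linarith
  have hD3 : 512 ≤ D := by nlinarith
  have hD0 : 0 < D := by linarith
  have kp : ∀ i j : ℕ, i ≤ j → k ^ i ≤ k ^ j := fun i j h => pow_le_pow_right₀ hk h
  by_cases hn4 : 4 ≤ B.card
  swap
  · left
    have : n ≤ 3 := by
      have : B.card ≤ 3 := by omega
      rw [hndef]; exact_mod_cast this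
    have := kp 0 21 (by norm_num)
    nlinarith
  obtain ⟨W, s, f, hs, hW0, hWcard, hWB, hWe⟩ := core_s12 B k hk h0 hneg hB hn4 hkB
  obtain ⟨u1, u2, u3⟩ := upper B W k hk hBne hneg hkB' hW0 hWe
  rw [← hndef] at hWcard u1 u2 u3
  have hWpos : (0:ℝ) < W.card := lt_of_lt_of_le (by positivity) hWcard
  rw [div_le_iff₀ (by positivity)] at hWcard
  have fin : (W.card : ℝ) ^ 2 ≤ (C ^ 2 + 2) * (32 ^ 5 * k ^ 15 * n) → N ≤ D * k ^ 21 := by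
    intro h
    have h1 : n ^ 2 ≤ (W.card : ℝ) ^ 2 * (128 * k ^ 2) ^ 2 := by
      rw [← mul_pow]; gcongr
    have h2 : n * n ≤ ((C ^ 2 + 2) * (32 ^ 5 * k ^ 15) * (128 * k ^ 2) ^ 2) * n := by
      calc n * n = n ^ 2 := by ring
        _ ≤ _ := h1
        _ ≤ ((C ^ 2 + 2) * (32 ^ 5 * k ^ 15 * n)) * (128 * k ^ 2) ^ 2 := by gcongr
        _ = _ := by ring
    have h3 := le_of_mul_le_mul_right h2 (by linarith)
    calc N ≤ 2 * n := hN2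
      _ ≤ 2 * ((C ^ 2 + 2) * (32 ^ 5 * k ^ 15) * (128 * k ^ 2) ^ 2) := by gcongr
      _ = (2 * (C ^ 2 + 2) * 128 ^ 2 * 32 ^ 5) * k ^ 19 := by ring
      _ ≤ D * k ^ 21 := by
        have := kp 19 21 (by norm_num)
        gcongr
  have fin1 : (W.card : ℝ) ^ 2 ≤ (32 ^ 5 * k ^ 15 * n) → N ≤ D * k ^ 21 := by
    intro h
    apply fin
    have : (0:ℝ) ≤ 32 ^ 5 * k ^ 15 * n := by positivity
    nlinarith
  by_cases hW2 : 2 ≤ W.card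
  swap
  · left
    have : (W.card : ℝ) ≤ 1 := by
      have : W.card ≤ 1 := by omega
      exact_mod_cast this
    have h2 := kp 2 21 (by norm_num)
    have hkk : 0 < k ^ 2 := by positivity
    have : n ≤ 128 * k ^ 2 := by nlinarith
    nlinarith
  by_cases hadd : ∀ r ∈ quotSet W, 1 + r ∈ quotSet W
  swap
  · left
    push Not at hadd
    obtain ⟨r, hr, hr'⟩ := hadd
    exact fin1 ((not_quot W _ hr').trans ((affine_le B W s f _ hs hWB).trans (u2 r hr)))
  by_cases hmul : ∀ w ∈ W, ∀ r ∈ quotSet W, w * r ∈ quotSet W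
  swap
  · left
    push Not at hmul
    obtain ⟨w, hw, r, hr, hr'⟩ := hmul
    exact fin1 ((not_quot W _ hr').trans ((affine_le B W s f _ hs hWB).trans (u3 w hw r hr)))
  obtain ⟨G, hG⟩ := quot_field W hW0 hW2 hadd hmul
  let Gf : Finset F := Finset.univ.filter fun x => x ∈ G
  have hGcard : (Gf.card : ℝ) = Nat.card G := by
    rw [Nat.card_eq_fintype_card, Fintype.card_subtype]
  have hGp : (0:ℝ) < Nat.card G := by exact_mod_cast Nat.card_pos
  obtain ⟨r, hr, hrep⟩ := few_rep W Gf ⟨0, by simp [Gf, G.zero_mem]⟩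
  have hrG : r ∈ quotSet W := by
    rw [← hG]; simpa [Gf] using hr
  have hup := (affine_le B W s f r hs hWB).trans (u1 r hrG)
  rw [hGcard] at hrep
  set g : ℝ := (Nat.card G : ℝ) with hgdef
  set M : ℝ := 32 ^ 5 * k ^ 15 * n with hM
  have hM0 : 0 < M := by positivity
  have hrep' : (W.card : ℝ) ^ 2 * g ≤ (W.card ^ 2 + g) * M := hrep.trans (by gcongr)
  by_cases htop : G = ⊤
  · have hgq : g = Fintype.card F := by
      rw [hgdef, htop, Nat.card_eq_fintype_card]
      norm_cast
      exact Fintype.card_congr Subfield.topEquiv.toEquiv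
    rcases le_total ((W.card : ℝ) ^ 2) g with h | h
    · left
      have h1 : g * (W.card : ℝ) ^ 2 ≤ g * (2 * M) := by
        calc g * (W.card : ℝ) ^ 2 = (W.card : ℝ) ^ 2 * g := by ring
          _ ≤ (W.card ^ 2 + g) * M := hrep'
          _ ≤ (g + g) * M := by gcongr
          _ = _ := by ring
      have h2 := le_of_mul_le_mul_left h1 hGp
      apply fin
      exact h2.trans (mul_le_mul_of_nonneg_right (by linarith) hM0.le)
    · right
      have h1 : (W.card : ℝ) ^ 2 * g ≤ (W.card : ℝ) ^ 2 * (2 * M) := by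
        calc (W.card : ℝ) ^ 2 * g ≤ (W.card ^ 2 + g) * M := hrep'
          _ ≤ (W.card ^ 2 + W.card ^ 2) * M := by gcongr
          _ = _ := by ring
      have h2 := le_of_mul_le_mul_left h1 (by positivity)
      rw [← hgq]
      calc g ≤ 2 * M := h2
        _ = 2 * 32 ^ 5 * k ^ 15 * n := by rw [hM]; ring
        _ ≤ D * k ^ 19 * N := by
          have := kp 15 19 (by norm_num)
          have : n ≤ N := by linarith
          have : (2:ℝ) * 32 ^ 5 ≤ D := by linarith
          gcongr
  · left
    obtain ⟨w0, hw0, w1, hw1, hw01⟩ := Finset.one_lt_card.1 hW2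
    have hcond := hsub G htop (s * (w1 - w0)) (f + s * w0)
    have hle : (W.card : ℝ) ≤ ((B.filter fun x => ∃ g ∈ G, x = s * (w1 - w0) * g + (f + s * w0)).card : ℝ) := by
      norm_cast
      apply Finset.card_le_card_of_injOn (fun w => f + s * w)
      · intro w hw
        simp only [Finset.coe_filter, Set.mem_ofPred_eq]
        refine ⟨hWB w hw, (w - w0) / (w1 - w0), ?_, ?_⟩
        · have : (w - w0) / (w1 - w0) ∈ (G : Set F) := by
            rw [hG]; exact ⟨w, hw, w0, hw0, w1, hw1, w0, hw0, Ne.symm hw01, rfl⟩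
          exact this
        · have : w1 - w0 ≠ 0 := sub_ne_zero.2 (Ne.symm hw01)
          field_simp
          ring
      · intro x _ y _ h
        exact mul_left_cancel₀ hs (add_left_cancel h)
    have hle' : (W.card : ℝ) ≤ C * max (g ^ ((1:ℝ)/2)) (N ^ ((4:ℝ)/7)) := by
      refine hle.trans (le_trans (le_of_eq ?_) hcond)
      congr!
    rcases le_total (g ^ ((1:ℝ)/2)) (N ^ ((4:ℝ)/7)) with h | h
    · rw [max_eq_right h] at hle'
      set z : ℝ := N ^ ((1:ℝ)/7) with hz
      have hz0 : 0 < z := by positivity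
      have hz4 : N ^ ((4:ℝ)/7) = z ^ 4 := by
        rw [hz, ← Real.rpow_natCast, ← Real.rpow_mul (by linarith)]; norm_num
      have hz7 : N = z ^ 7 := by
        rw [hz, ← Real.rpow_natCast, ← Real.rpow_mul (by linarith)]; norm_num
      rw [hz4] at hle'
      have h1 : z ^ 4 * z ^ 3 ≤ z ^ 4 * (256 * C * k ^ 2) := by
        calc z ^ 4 * z ^ 3 = N := by rw [hz7]; ring
          _ ≤ 2 * n := hN2
          _ ≤ 2 * (W.card * (128 * k ^ 2)) := by gcongr
          _ ≤ 2 * ((C * z ^ 4) * (128 * k ^ 2)) := by gcongr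
          _ = _ := by ring
      have h2 := le_of_mul_le_mul_left h1 (by positivity)
      calc N ≤ N ^ 3 := le_self_pow₀ hN1 (by norm_num)
        _ = (z ^ 3) ^ 7 := by rw [hz7]; ring
        _ ≤ (256 * C * k ^ 2) ^ 7 := by gcongr
        _ = (256 * C) ^ 7 * k ^ 14 := by ring
        _ ≤ D * k ^ 21 := by
          have := kp 14 21 (by norm_num)
          gcongr
    · rw [max_eq_left h, ← Real.sqrt_eq_rpow] at hle'
      have h1 : (W.card : ℝ) ^ 2 ≤ C ^ 2 * g := by
        calc (W.card : ℝ) ^ 2 ≤ (C * Real.sqrt g) ^ 2 := by gcongr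
          _ = C ^ 2 * g := by rw [mul_pow, Real.sq_sqrt hGp.le]
      apply fin
      have h2 : g * (W.card : ℝ) ^ 2 ≤ g * ((C ^ 2 + 2) * M) := by
        calc g * (W.card : ℝ) ^ 2 ≤ (W.card ^ 2 + g) * M := by linarith
          _ ≤ (C ^ 2 * g + g) * M := by gcongr
          _ = g * ((C ^ 2 + 1) * M) := by ring
          _ ≤ _ := by gcongr; norm_num
      exact le_of_mul_le_mul_left h2 hGp

lemma final_ineq (D k N n q L : ℝ) (hD : 1 ≤ D) (hk : 1 ≤ k) (hN : 2 ≤ N) (hn : N ≤ 2 * n)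
    (hq : 0 ≤ q)
    (h : N ≤ D * k ^ 21 ∨ q ≤ D * k ^ 19 * N) (hL : L = Real.log N) :
    (Real.log 2) ^ ((1:ℝ)/3) / (2 * D) * L ^ (-(1:ℝ)/3) *
      min (N ^ ((1:ℝ) + 1/21)) (q ^ ((1:ℝ)/19) * N ^ ((1:ℝ) - 1/19)) ≤ k * n := by
  have hN0 : 0 < N := by linarith
  have hD0 : 0 < D := by linarith
  have hk0 : 0 < k := by linarith
  have hl2 : 0 < Real.log 2 := Real.log_pos (by norm_num)
  have hmin : min (N ^ ((1:ℝ) + 1/21)) (q ^ ((1:ℝ)/19) * N ^ ((1:ℝ) - 1/19)) ≤ D * k * N := by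
    rcases h with h | h
    · refine (min_le_left _ _).trans ?_
      rw [Real.rpow_add hN0, Real.rpow_one]
      have h1 : N ≤ (D * k) ^ 21 := by
        refine h.trans ?_
        rw [mul_pow]
        have : D ≤ D ^ 21 := le_self_pow₀ hD (by norm_num)
        gcongr
      have h2 : N ^ ((1:ℝ)/21) ≤ D * k := by
        calc N ^ ((1:ℝ)/21) ≤ ((D * k) ^ 21) ^ ((1:ℝ)/21) := by gcongr
          _ = D * k := by
            rw [← Real.rpow_natCast, ← Real.rpow_mul (by positivity)]; norm_num
      calc N * N ^ ((1:ℝ)/21) ≤ N * (D * k) := by gcongr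
        _ = _ := by ring
    · refine (min_le_right _ _).trans ?_
      have h1 : q ≤ (D * k) ^ 19 * N := by
        refine h.trans ?_
        rw [mul_pow]
        have : D ≤ D ^ 19 := le_self_pow₀ hD (by norm_num)
        gcongr
      have h2 : q ^ ((1:ℝ)/19) ≤ D * k * N ^ ((1:ℝ)/19) := by
        calc q ^ ((1:ℝ)/19) ≤ ((D * k) ^ 19 * N) ^ ((1:ℝ)/19) := by gcongr
          _ = D * k * N ^ ((1:ℝ)/19) := by
            rw [Real.mul_rpow (by positivity) hN0.le, ← Real.rpow_natCast,
              ← Real.rpow_mul (by positivity)]; norm_num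
      calc q ^ ((1:ℝ)/19) * N ^ ((1:ℝ) - 1/19)
          ≤ D * k * N ^ ((1:ℝ)/19) * N ^ ((1:ℝ) - 1/19) := by gcongr
        _ = D * k * (N ^ ((1:ℝ)/19 + (1 - 1/19))) := by rw [Real.rpow_add hN0]; ring
        _ = _ := by norm_num
  have hlog : L ^ (-(1:ℝ)/3) ≤ (Real.log 2) ^ (-(1:ℝ)/3) := by
    apply Real.rpow_le_rpow_of_nonpos hl2 _ (by norm_num)
    rw [hL]
    exact Real.log_le_log (by norm_num) hN
  have hL0 : 0 ≤ L := by rw [hL]; exact Real.log_nonneg (by linarith)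
  have hmin0 : 0 ≤ min (N ^ ((1:ℝ) + 1/21)) (q ^ ((1:ℝ)/19) * N ^ ((1:ℝ) - 1/19)) :=
    le_min (by positivity) (by positivity)
  have hone : (Real.log 2) ^ ((1:ℝ)/3) * (Real.log 2) ^ (-(1:ℝ)/3) = 1 := by
    rw [← Real.rpow_add hl2]; norm_num
  calc _ ≤ (Real.log 2) ^ ((1:ℝ)/3) / (2 * D) * (Real.log 2) ^ (-(1:ℝ)/3) * (D * k * N) := by
        gcongr
    _ = ((Real.log 2) ^ ((1:ℝ)/3) * (Real.log 2) ^ (-(1:ℝ)/3)) * (k * (N / 2)) := by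
        field_simp
    _ = k * (N / 2) := by rw [hone, one_mul]
    _ ≤ k * n := by gcongr; linarith

theorem stmt12 : ∀ C : ℝ, 0 < C → ∃ c' : ℝ, 0 < c' ∧
    ∀ (F : Type) [Field F] [Fintype F] (q : ℕ), IsPrimePow q → Fintype.card F = q →
    ∀ A : Finset F, 2 ≤ A.card →
    (0:F) ∈ A → (∀ x ∈ A, ∀ y ∈ A, x + y ∈ A) → (∀ x ∈ A, -x ∈ A) →
    subfieldCond ((A.erase 0).image fun x => x⁻¹) C ((A.card : ℝ) ^ ((4:ℝ)/7)) →
    c' * (Real.log (A.card : ℝ)) ^ (-(1:ℝ)/3) *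
        min ((A.card : ℝ) ^ ((1:ℝ) + 1/21))
          ((q : ℝ) ^ ((1:ℝ)/19) * (A.card : ℝ) ^ ((1:ℝ) - 1/19)) ≤
      (((((A.erase 0).image fun x => x⁻¹) + ((A.erase 0).image fun x => x⁻¹)).card : ℝ)) ∧
    c' * (Real.log (A.card : ℝ)) ^ (-(1:ℝ)/3) *
        min ((A.card : ℝ) ^ ((1:ℝ) + 1/21))
          ((q : ℝ) ^ ((1:ℝ)/19) * (A.card : ℝ) ^ ((1:ℝ) - 1/19)) ≤
      (((((A.erase 0).image fun x => x⁻¹) - ((A.erase 0).image fun x => x⁻¹)).card : ℝ)) := by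
  intro C hC
  set D : ℝ := 2 * (C ^ 2 + 2) * 128 ^ 2 * 32 ^ 5 + (256 * C) ^ 7 with hD
  have hD1 : 1 ≤ D := by
    have h1 : (0:ℝ) < (256 * C) ^ 7 := by positivity
    have h2 : (0:ℝ) < C ^ 2 := by positivity
    linarith
  have hl2 : 0 < Real.log 2 := Real.log_pos (by norm_num)
  refine ⟨(Real.log 2) ^ ((1:ℝ)/3) / (2 * D), by positivity, ?_⟩
  intro F _ _ q _ hq A hA h0 hadd hnegA hsub
  set B : Finset F := (A.erase 0).image fun x => x⁻¹ with hBdef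
  have hBcard : B.card = A.card - 1 := by
    rw [hBdef, Finset.card_image_of_injective _ inv_injective, Finset.card_erase_of_mem h0]
  have hmem : ∀ b, b ∈ B ↔ ∃ x ∈ A, x ≠ 0 ∧ x⁻¹ = b := by
    intro b
    rw [hBdef, Finset.mem_image]
    constructor
    · rintro ⟨x, hx, rfl⟩
      exact ⟨x, (Finset.mem_erase.1 hx).2, (Finset.mem_erase.1 hx).1, rfl⟩
    · rintro ⟨x, hx, hx0, rfl⟩
      exact ⟨x, Finset.mem_erase.2 ⟨hx0, hx⟩, rfl⟩
  have hB0 : (0:F) ∉ B := by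
    rw [hmem]
    rintro ⟨x, _, hx0, hx⟩
    exact hx0 (inv_eq_zero.1 hx)
  have hneg : ∀ b ∈ B, -b ∈ B := by
    intro b hb
    obtain ⟨x, hx, hx0, rfl⟩ := (hmem b).1 hb
    exact (hmem _).2 ⟨-x, hnegA x hx, neg_ne_zero.2 hx0, inv_neg⟩
  have hBB : ∀ b ∈ B, ∀ c ∈ B, b ≠ c → b * c / (b - c) ∈ B := by
    intro b hb c hc hbc
    obtain ⟨x, hx, hx0, rfl⟩ := (hmem b).1 hb
    obtain ⟨y, hy, hy0, rfl⟩ := (hmem c).1 hc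
    have hyx : y - x ≠ 0 := fun h => hbc (by rw [sub_eq_zero.1 h])
    refine (hmem _).2 ⟨y - x, ?_, hyx, ?_⟩
    · rw [sub_eq_add_neg]; exact hadd _ hy _ (hnegA _ hx)
    · have : x⁻¹ - y⁻¹ = (y - x) * (x⁻¹ * y⁻¹) := by field_simp
      rw [this]
      field_simp
  have hBpos : 0 < B.card := by omega
  have hBne : B.Nonempty := Finset.card_pos.1 hBpos
  have hnegB : -B = B := by
    apply Finset.eq_of_subset_of_card_le
    · intro x hx
      have := hneg _ (Finset.mem_neg'.1 hx)
      simpa using this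
    · rw [Finset.card_neg]
  have hsum : B - B = B + B := by rw [sub_eq_add_neg, hnegB]
  have hn0 : (0:ℝ) < B.card := by exact_mod_cast hBpos
  set k : ℝ := ((B + B).card : ℝ) / B.card with hkdef
  have hkB : ((B + B).card : ℝ) = k * B.card := by rw [hkdef]; field_simp
  have hk : 1 ≤ k := by
    rw [hkdef, one_le_div hn0]
    exact_mod_cast Finset.card_le_card_add_right hBne
  have hN : (A.card : ℝ) = B.card + 1 := by
    have : A.card = B.card + 1 := by omega
    exact_mod_cast this
  have hm := main B C A.card k hC hk hB0 hneg hBB hBne (by rw [hsum]; exact hkB) hkB hN hsub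
  rw [hq] at hm
  have hN2 : (2:ℝ) ≤ A.card := by exact_mod_cast hA
  have hfin := final_ineq D k A.card B.card q _ hD1 hk hN2 (by linarith) (by positivity) hm rfl
  rw [← hkB] at hfin
  exact ⟨hfin, by rw [hsum]; exact hfin⟩

end STP
end
end
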